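/- arXiv:0706.2552 — 2 statements merged into one kernel-verified Lean document; each statement's English description precedes it below -/
import Mathlib

section
/- Let n ≥ 3 be odd and let D be the linear span (inside C^∞(ℝⁿ,ℂ)) of all smoothing symbols and all odd-class classical symbols with constant coefficients on ℝⁿ. Let K be a positive integer with K ≤ n and let ρ₁, ρ₂ : D → ℂ be linear forms with Stokes' property on D (i.e. ρ_k(∂_{ξ_i}τ) = 0 whenever τ ∈ D and ∂_{ξ_i}τ ∈ D, for i = 1,…,n). If ρ₁(σ) = ρ₂(σ) for every element σ of D that is a classical symbol of order with real part < −K, then ρ₁ = ρ₂ on all of D. -/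
open MeasureTheory Metric Filter Complex
open scoped Topology RealInnerProductSpace Classical

noncomputable section

/-- ℝⁿ with the euclidean norm. -/
abbrev Euc (n : ℕ) := EuclideanSpace ℝ (Fin n)

/-- Partial derivative in the `i`-th coordinate direction. -/
def pd {n : ℕ} (i : Fin n) (f : Euc n → ℂ) : Euc n → ℂ :=
  fun ξ => fderiv ℝ f ξ (EuclideanSpace.single i 1)

/-- Iterated partial derivatives along a list of coordinate directions
(a multi-index `β` corresponds to the lists containing `i` exactly `β i` times). -/
def pdIter {n : ℕ} : List (Fin n) → (Euc n → ℂ) → (Euc n → ℂ)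
  | [], f => f
  | i :: L, f => pd i (pdIter L f)

/-- A smooth cut-off function vanishing near `0` and equal to `1` outside the unit ball. -/
structure IsCutoff {n : ℕ} (χ : Euc n → ℝ) : Prop where
  smooth : ContDiff ℝ (⊤ : ℕ∞) χ
  zero_near : ∃ ε > (0:ℝ), ∀ ξ : Euc n, ‖ξ‖ < ε → χ ξ = 0
  one_far : ∀ ξ : Euc n, 1 ≤ ‖ξ‖ → χ ξ = 1

/-- `σ` is a classical symbol of order `a` with constant coefficients on `ℝⁿ`, with
homogeneous components `σc j` of degree `a - j`. -/
structure IsCS {n : ℕ} (χ : Euc n → ℝ) (a : ℂ) (σ : Euc n → ℂ)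
    (σc : ℕ → Euc n → ℂ) : Prop where
  smooth : ContDiff ℝ (⊤ : ℕ∞) σ
  comp_smooth : ∀ j, ContDiffOn ℝ (⊤ : ℕ∞) (σc j) {(0 : Euc n)}ᶜ
  comp_homog : ∀ (j : ℕ) (t : ℝ), 0 < t → ∀ ξ : Euc n, ξ ≠ 0 →
    σc j (t • ξ) = (t : ℂ) ^ (a - j) * σc j ξ
  estimate : ∀ (N : ℕ) (L : List (Fin n)), ∃ C > (0:ℝ), ∀ ξ : Euc n,
    ‖pdIter L (fun η => σ η - ∑ j ∈ Finset.range N, (χ η : ℂ) * σc j η) ξ‖ ≤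
      C * (1 + ‖ξ‖) ^ (a.re - N - L.length : ℝ)

/-- A smoothing symbol with constant coefficients on `ℝⁿ`. -/
def IsSmoothing {n : ℕ} (σ : Euc n → ℂ) : Prop :=
  ContDiff ℝ (⊤ : ℕ∞) σ ∧
    ∀ (L : List (Fin n)) (M : ℝ), 0 < M → ∃ C > (0:ℝ), ∀ ξ : Euc n,
      ‖pdIter L σ ξ‖ ≤ C * (1 + ‖ξ‖) ^ (-M)

/-- The surface measure on the unit sphere `S^{n-1} ⊂ ℝⁿ`. -/
def sphMeas (n : ℕ) : Measure (sphere (0 : Euc n) 1) :=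
  (volume : Measure (Euc n)).toSphere

/-- The integral of a homogeneous component over the unit sphere. -/
def sphInt {n : ℕ} (f : Euc n → ℂ) : ℂ :=
  ∫ ω : sphere (0 : Euc n) 1, f ↑ω ∂(sphMeas n)

/-- The noncommutative residue of a classical symbol of order `a` with homogeneous
components `σc j` of degree `a - j`. -/
def resCC {n : ℕ} (a : ℂ) (σc : ℕ → Euc n → ℂ) : ℂ :=
  if h : ∃ j : ℕ, a - j = -(n : ℂ) then
    (((2 * Real.pi) ^ (-(n : ℝ) / 2) : ℝ) : ℂ) * sphInt (σc h.choose)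
  else 0

/-- The cut-off regularised integral of a classical symbol of order `a` with homogeneous
components `σc`, computed with an integer `N` such that `Re a - N < -n`. -/
def cutoffInt {n : ℕ} (χ : Euc n → ℝ) (a : ℂ) (σ : Euc n → ℂ)
    (σc : ℕ → Euc n → ℂ) (N : ℕ) : ℂ :=
  (∫ ξ : Euc n, (σ ξ - ∑ j ∈ Finset.range N, (χ ξ : ℂ) * σc j ξ))
  + ∑ j ∈ Finset.range N, ∫ ξ in Metric.ball (0 : Euc n) 1, (χ ξ : ℂ) * σc j ξ
  - ∑ j ∈ Finset.range N,
      if a - j + n ≠ 0 then (a - j + n)⁻¹ * sphInt (σc j) else 0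


/-- The linear span of all smoothing symbols and all odd-class classical symbols with
constant coefficients on `ℝⁿ`. -/
def Dodd (n : ℕ) (χ : Euc n → ℝ) : Submodule ℂ (Euc n → ℂ) :=
  Submodule.span ℂ
    {σ | IsSmoothing σ ∨ ∃ (a : ℤ) (σc : ℕ → Euc n → ℂ), IsCS χ (a : ℂ) σ σc ∧
      ∀ (j : ℕ) (ξ : Euc n), ξ ≠ 0 →
        σc j (-ξ) = (-1 : ℂ) ^ (a - (j : ℤ)) * σc j ξ}

/-- Smooth functions on `ℝⁿ ∖ {0}` that satisfy `f (c ξ) = c ^ m f ξ` for all real `c ≠ 0`, i.e.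
positively homogeneous functions of degree `m` with parity `(-1) ^ m`. -/
structure IsOddHom {n : ℕ} (m : ℤ) (f : Euc n → ℂ) : Prop where
  smooth : ContDiffOn ℝ (⊤ : ℕ∞) f {(0 : Euc n)}ᶜ
  homog : ∀ c : ℝ, c ≠ 0 → ∀ ξ : Euc n, ξ ≠ 0 → f (c • ξ) = (c : ℂ) ^ m * f ξ

/-- Multiplication by the cut-off function. -/
def cut {n : ℕ} (χ : Euc n → ℝ) : (Euc n → ℂ) →ₗ[ℂ] (Euc n → ℂ) where
  toFun f := fun η => (χ η : ℂ) * f η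
  map_add' f g := by ext; simp [mul_add]
  map_smul' c f := by ext; simp [mul_left_comm]

section Derivatives

variable {n : ℕ}

lemma pd_contDiff {f : Euc n → ℂ} (hf : ContDiff ℝ (⊤ : ℕ∞) f) (i : Fin n) :
    ContDiff ℝ (⊤ : ℕ∞) (pd i f) :=
  (hf.fderiv_right (m := (⊤ : ℕ∞)) (by simp)).clm_apply contDiff_const

lemma pdIter_contDiff {f : Euc n → ℂ} (hf : ContDiff ℝ (⊤ : ℕ∞) f) (L : List (Fin n)) :
    ContDiff ℝ (⊤ : ℕ∞) (pdIter L f) := by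
  induction L with
  | nil => exact hf
  | cons i L ih => exact pd_contDiff ih i

lemma pd_eqOn {s : Set (Euc n)} (hs : IsOpen s) {f g : Euc n → ℂ} (h : Set.EqOn f g s)
    (i : Fin n) : Set.EqOn (pd i f) (pd i g) s := fun x hx => by
  simp only [pd]
  rw [(h.eventuallyEq_of_mem (hs.mem_nhds hx)).fderiv_eq]

lemma pdIter_eqOn {s : Set (Euc n)} (hs : IsOpen s) {f g : Euc n → ℂ} (h : Set.EqOn f g s)
    (L : List (Fin n)) : Set.EqOn (pdIter L f) (pdIter L g) s := by
  induction L with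
  | nil => exact h
  | cons i L ih => exact pd_eqOn hs ih i

@[simp]
lemma pd_zero (i : Fin n) : pd i (fun _ : Euc n => (0 : ℂ)) = fun _ => 0 := by
  ext; simp [pd]

@[simp]
lemma pdIter_zero (L : List (Fin n)) : pdIter L (fun _ : Euc n => (0 : ℂ)) = fun _ => 0 := by
  induction L with
  | nil => rfl
  | cons i L ih => simp [pdIter, ih]

lemma contDiff_coord (i : Fin n) : ContDiff ℝ (⊤ : ℕ∞) (fun ξ : Euc n => ((ξ i : ℝ) : ℂ)) :=
  Complex.ofRealCLM.contDiff.comp (EuclideanSpace.proj (𝕜 := ℝ) i).contDiff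

lemma pd_coord_mul {f : Euc n → ℂ} {ξ : Euc n} (hf : DifferentiableAt ℝ f ξ) (i j : Fin n) :
    pd j (fun η => ((η i : ℝ) : ℂ) * f η) ξ =
      (ξ i : ℂ) * pd j f ξ + (if i = j then f ξ else 0) := by
  have h1 : HasFDerivAt (fun η : Euc n => ((η i : ℝ) : ℂ))
      (Complex.ofRealCLM.comp (EuclideanSpace.proj (𝕜 := ℝ) i)) ξ :=
    (Complex.ofRealCLM.comp (EuclideanSpace.proj (𝕜 := ℝ) i)).hasFDerivAt
  have h2 := h1.mul hf.hasFDerivAt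
  simp only [pd]
  erw [h2.fderiv]
  split_ifs with h <;> simp [h]

end Derivatives

namespace IsOddHom

variable {n : ℕ} {m : ℤ} {f : Euc n → ℂ}

lemma differentiableAt (hf : IsOddHom m f) {ξ : Euc n} (hξ : ξ ≠ 0) : DifferentiableAt ℝ f ξ :=
  (hf.smooth.differentiableOn (by simp)).differentiableAt (isOpen_compl_singleton.mem_nhds hξ)

lemma comp (hf : IsOddHom m f) {A : Euc n → Euc n} (hA : ContDiff ℝ (⊤ : ℕ∞) A)
    (hA_smul : ∀ (c : ℝ) ξ, A (c • ξ) = c • A ξ) (hA_ne : ∀ ξ, ξ ≠ 0 → A ξ ≠ 0) :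
    IsOddHom m (fun ξ => f (A ξ)) where
  smooth := hf.smooth.comp hA.contDiffOn fun ξ hξ => hA_ne ξ hξ
  homog c hc ξ hξ := by rw [hA_smul, hf.homog c hc _ (hA_ne ξ hξ)]

lemma coord_mul (hf : IsOddHom m f) (i : Fin n) :
    IsOddHom (m + 1) (fun ξ => (ξ i : ℂ) * f ξ) where
  smooth := (contDiff_coord i).contDiffOn.mul hf.smooth
  homog c hc ξ hξ := by
    have hc' : (c : ℂ) ≠ 0 := by exact_mod_cast hc
    rw [hf.homog c hc ξ hξ, zpow_add_one₀ hc']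
    simp
    ring

lemma pd (hf : IsOddHom m f) (i : Fin n) : IsOddHom (m - 1) (pd i f) where
  smooth := (hf.smooth.fderiv_of_isOpen isOpen_compl_singleton (by simp)).clm_apply
    contDiffOn_const
  homog c hc ξ hξ := by
    have hc' : (c : ℂ) ≠ 0 := by exact_mod_cast hc
    have h1 : (fun η => f (c • η)) =ᶠ[𝓝 ξ] fun η => (c : ℂ) ^ m * f η := by
      filter_upwards [isOpen_compl_singleton.mem_nhds hξ] with η hη using hf.homog c hc η hη
    have h2 := h1.fderiv_eq (𝕜 := ℝ)
    rw [fderiv_const_mul (hf.differentiableAt hξ)] at h2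
    have h3 : HasFDerivAt (fun η : Euc n => c • η) (c • ContinuousLinearMap.id ℝ (Euc n)) ξ :=
      (hasFDerivAt_id ξ).const_smul c
    have h4 := ((hf.differentiableAt (smul_ne_zero hc hξ)).hasFDerivAt.comp ξ h3).fderiv
    have h5 := h4.symm.trans h2
    have h6 := congrArg (fun T => T (EuclideanSpace.single i (1 : ℝ))) h5
    simp only [ContinuousLinearMap.comp_apply, _root_.smul_apply,
      ContinuousLinearMap.id_apply, map_smul, smul_eq_mul, Complex.real_smul] at h6
    simp only [_root_.pd]
    rw [zpow_sub_one₀ hc']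
    field_simp
    linear_combination h6

lemma pdIter (hf : IsOddHom m f) (L : List (Fin n)) :
    IsOddHom (m - L.length) (pdIter L f) := by
  induction L with
  | nil => simpa [_root_.pdIter] using hf
  | cons i L ih =>
    have := ih.pd i
    simpa [_root_.pdIter, sub_sub] using this

/-- Euler's identity. -/
lemma sum_coord_mul_pd (hf : IsOddHom m f) {ξ : Euc n} (hξ : ξ ≠ 0) :
    ∑ i, (ξ i : ℂ) * _root_.pd i f ξ = m * f ξ := by
  have h1 : HasDerivAt (fun t : ℝ => t • ξ) ξ 1 := by
    simpa using (hasDerivAt_id (1 : ℝ)).smul_const ξ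
  have h2 : HasDerivAt (fun t : ℝ => f (t • ξ)) (fderiv ℝ f ξ ξ) 1 := by
    have := (hf.differentiableAt hξ).hasFDerivAt
    exact HasFDerivAt.comp_hasDerivAt (1 : ℝ) (by simpa using this) h1
  have h3 : HasDerivAt (fun t : ℝ => ((t : ℂ)) ^ m * f ξ) (m * f ξ) 1 := by
    have := (hasDerivAt_zpow m ((1 : ℝ) : ℂ) (by simp)).comp_ofReal
    simpa using this.mul_const (f ξ)
  have h4 : (fun t : ℝ => f (t • ξ)) =ᶠ[𝓝 1] fun t : ℝ => ((t : ℂ)) ^ m * f ξ := by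
    filter_upwards [isOpen_compl_singleton.mem_nhds (one_ne_zero (α := ℝ))] with t ht
      using hf.homog t ht ξ hξ
  rw [(h3.congr_of_eventuallyEq h4).unique h2]
  have h5 : ξ = ∑ i, ξ i • EuclideanSpace.single i (1 : ℝ) := by
    ext k
    simp [Pi.single_apply]
  conv_rhs => rw [h5, map_sum]
  simp [_root_.pd, ← h5]

lemma exists_bound (hf : IsOddHom m f) :
    ∃ C : ℝ, ∀ ξ : Euc n, 1 ≤ ‖ξ‖ → ‖f ξ‖ ≤ C * (1 + ‖ξ‖) ^ (m : ℝ) := by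
  obtain ⟨C, hC⟩ := (isCompact_sphere (0 : Euc n) 1).exists_bound_of_continuousOn
    (hf.smooth.continuousOn.mono fun ξ hξ h0 => by simp_all)
  refine ⟨|C| * (1 / 2 : ℝ) ^ (-|(m : ℝ)|), fun ξ hξ => ?_⟩
  have hpos : 0 < ‖ξ‖ := by linarith
  have hξ0 : ξ ≠ 0 := norm_pos_iff.1 hpos
  have h1 : f ξ = (‖ξ‖ : ℂ) ^ m * f (‖ξ‖⁻¹ • ξ) := by
    rw [← hf.homog _ hpos.ne' _ (smul_ne_zero (inv_ne_zero hpos.ne') hξ0), smul_smul,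
      mul_inv_cancel₀ hpos.ne', one_smul]
  have h2 : ‖f (‖ξ‖⁻¹ • ξ)‖ ≤ |C| :=
    (hC _ (by simp [norm_smul, hpos.ne'])).trans (le_abs_self C)
  have h3 : ‖ξ‖ ^ (m : ℝ) ≤ (1 / 2 : ℝ) ^ (-|(m : ℝ)|) * (1 + ‖ξ‖) ^ (m : ℝ) := by
    rw [← div_le_iff₀ (by positivity), ← Real.div_rpow (by positivity) (by positivity)]
    have hr : 1 / 2 ≤ ‖ξ‖ / (1 + ‖ξ‖) := by
      rw [div_le_div_iff₀ (by norm_num) (by positivity)]; linarith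
    calc (‖ξ‖ / (1 + ‖ξ‖)) ^ (m : ℝ) ≤ (‖ξ‖ / (1 + ‖ξ‖)) ^ (-|(m : ℝ)|) :=
          Real.rpow_le_rpow_of_exponent_ge (by positivity)
            (by rw [div_le_one (by positivity)]; linarith) (neg_abs_le _)
      _ ≤ _ := Real.rpow_le_rpow_of_nonpos (by norm_num) hr (by simp)
  rw [h1, norm_mul, norm_zpow, Complex.norm_real, norm_norm, ← Real.rpow_intCast]
  calc _ ≤ ((1 / 2 : ℝ) ^ (-|(m : ℝ)|) * (1 + ‖ξ‖) ^ (m : ℝ)) * |C| := by gcongr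
    _ = _ := by ring

end IsOddHom

section Symbols

variable {n : ℕ} {χ : Euc n → ℝ}

lemma exists_bound_of_far {F : Euc n → ℂ} (hF : Continuous F) {k C : ℝ}
    (h : ∀ ξ, 1 < ‖ξ‖ → ‖F ξ‖ ≤ C * (1 + ‖ξ‖) ^ k) :
    ∃ C > (0 : ℝ), ∀ ξ, ‖F ξ‖ ≤ C * (1 + ‖ξ‖) ^ k := by
  have hG : Continuous fun ξ : Euc n => ‖F ξ‖ / (1 + ‖ξ‖) ^ k :=
    hF.norm.div ((continuous_const.add continuous_norm).rpow_const fun ξ => Or.inl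
      (add_pos_of_pos_of_nonneg one_pos (norm_nonneg ξ)).ne')
      fun ξ => (Real.rpow_pos_of_pos (by positivity) k).ne'
  obtain ⟨B, hB⟩ := (isCompact_closedBall (0 : Euc n) 1).exists_bound_of_continuousOn
    hG.continuousOn
  refine ⟨max 1 (max B C), by positivity, fun ξ => ?_⟩
  rcases le_or_gt ‖ξ‖ 1 with h1 | h1
  · have := (le_abs_self _).trans (hB ξ (by simpa using h1))
    rw [div_le_iff₀ (by positivity)] at this
    refine this.trans ?_
    gcongr
    simp
  · refine (h ξ h1).trans ?_
    gcongr
    simp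

lemma isOpen_far : IsOpen {ξ : Euc n | 1 < ‖ξ‖} := isOpen_lt continuous_const continuous_norm

lemma isSmoothing_of_far_eq_zero {σ : Euc n → ℂ} (hσ : ContDiff ℝ (⊤ : ℕ∞) σ)
    (h : ∀ ξ, 1 < ‖ξ‖ → σ ξ = 0) : IsSmoothing σ := by
  refine ⟨hσ, fun L M _ => exists_bound_of_far (C := 0) (pdIter_contDiff hσ L).continuous
    fun ξ hξ => ?_⟩
  rw [pdIter_eqOn isOpen_far (g := fun _ => 0) h L hξ]
  simp

lemma IsSmoothing.isCS {σ : Euc n → ℂ} (hσ : IsSmoothing σ) {a : ℂ} (ha : a.re < 0) :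
    IsCS χ a σ (fun _ _ => 0) where
  smooth := hσ.1
  comp_smooth _ := contDiffOn_const
  comp_homog := by simp
  estimate N L := by
    obtain ⟨C, hC, h⟩ := hσ.2 L (-(a.re - N - L.length)) (by
      have : (0 : ℝ) ≤ N + L.length := by positivity
      linarith)
    exact ⟨C, hC, by simpa using h⟩

lemma IsCS.sub_sum {a : ℂ} {σ : Euc n → ℂ} {σc : ℕ → Euc n → ℂ}
    (h : IsCS χ a σ σc) (N : ℕ)
    (hsm : ∀ j, ContDiff ℝ (⊤ : ℕ∞) (cut χ (σc j))) :
    IsCS χ (a - N) (σ - ∑ j ∈ Finset.range N, cut χ (σc j)) (fun j => σc (N + j)) where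
  smooth := by
    refine h.smooth.sub ?_
    rw [show ∑ j ∈ Finset.range N, cut χ (σc j) = fun ξ => ∑ j ∈ Finset.range N, cut χ (σc j) ξ by
      ext; simp]
    exact ContDiff.sum fun j _ => hsm j
  comp_smooth j := h.comp_smooth _
  comp_homog j t ht ξ hξ := by
    rw [h.comp_homog (N + j) t ht ξ hξ]
    push_cast
    ring_nf
  estimate M L := by
    obtain ⟨C, hC, hb⟩ := h.estimate (N + M) L
    refine ⟨C, hC, fun ξ => ?_⟩
    rw [show (fun η => (σ - ∑ j ∈ Finset.range N, cut χ (σc j)) η -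
        ∑ j ∈ Finset.range M, (χ η : ℂ) * σc (N + j) η) =
        fun η => σ η - ∑ j ∈ Finset.range (N + M), (χ η : ℂ) * σc j η by
      ext η
      simp [cut, Finset.sum_range_add, sub_sub]]
    convert hb ξ using 3
    simp
    ring

lemma IsCutoff.cut_congr (hχ : IsCutoff χ) {f g : Euc n → ℂ} (h : ∀ ξ, ξ ≠ 0 → f ξ = g ξ) :
    cut χ f = cut χ g := by
  obtain ⟨ε, hε, h0⟩ := hχ.zero_near
  ext ξ
  by_cases hξ : ξ = 0
  · simp [cut, h0 ξ (by simpa [hξ] using hε)]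
  · simp [cut, h ξ hξ]

lemma IsCutoff.cut_eqOn (hχ : IsCutoff χ) (f : Euc n → ℂ) :
    Set.EqOn (cut χ f) f {ξ : Euc n | 1 < ‖ξ‖} := fun ξ hξ => by
  simp [cut, hχ.one_far ξ (le_of_lt hξ)]

lemma IsCutoff.contDiff_cut (hχ : IsCutoff χ) {f : Euc n → ℂ}
    (hf : ContDiffOn ℝ (⊤ : ℕ∞) f {(0 : Euc n)}ᶜ) : ContDiff ℝ (⊤ : ℕ∞) (cut χ f) := by
  obtain ⟨ε, hε, h0⟩ := hχ.zero_near
  rw [contDiff_iff_contDiffAt]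
  intro ξ
  by_cases hξ : ξ = 0
  · refine (contDiffAt_const (c := (0 : ℂ))).congr_of_eventuallyEq ?_
    filter_upwards [ball_mem_nhds ξ hε] with η hη
    simp [cut, h0 η (by simpa [hξ] using hη)]
  · exact (Complex.ofRealCLM.contDiff.comp hχ.smooth).contDiffAt.mul
      (hf.contDiffAt (isOpen_compl_singleton.mem_nhds hξ))

lemma IsCutoff.isCS_cut (hχ : IsCutoff χ) {m : ℤ} {f : Euc n → ℂ} (hf : IsOddHom m f) :
    IsCS χ (m : ℂ) (cut χ f) (fun j => if j = 0 then f else fun _ => 0) where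
  smooth := hχ.contDiff_cut hf.smooth
  comp_smooth j := by
    split_ifs
    exacts [hf.smooth, contDiffOn_const]
  comp_homog j t ht ξ hξ := by
    split_ifs with hj
    · simp [hj, hf.homog t ht.ne' ξ hξ]
    · simp
  estimate N L := by
    rcases N with _ | N
    · obtain ⟨C, hC⟩ := (hf.pdIter L).exists_bound
      simp only [Finset.range_zero, Finset.sum_empty, sub_zero]
      refine exists_bound_of_far (C := C)
        (pdIter_contDiff (hχ.contDiff_cut hf.smooth) L).continuous fun ξ hξ => ?_
      rw [pdIter_eqOn isOpen_far (hχ.cut_eqOn f) L hξ]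
      simpa using hC ξ hξ.le
    · refine ⟨1, one_pos, fun ξ => ?_⟩
      have : (fun η => cut χ f η - ∑ j ∈ Finset.range (N + 1),
          (χ η : ℂ) * (if j = 0 then f else fun _ => 0) η) = fun _ => 0 := by
        ext η
        simp [Finset.sum_range_succ', cut]
      rw [this, pdIter_zero]
      simp only [norm_zero]
      positivity

lemma IsCutoff.cut_mem_Dodd (hχ : IsCutoff χ) {m : ℤ} {f : Euc n → ℂ} (hf : IsOddHom m f) :
    cut χ f ∈ Dodd n χ := by
  refine Submodule.subset_span (Or.inr ⟨m, _, hχ.isCS_cut hf, fun j ξ hξ => ?_⟩)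
  split_ifs with hj
  · have := hf.homog (-1) (by norm_num) ξ hξ
    simpa [hj] using this
  · simp

lemma IsCS.isOddHom {a : ℤ} {σ : Euc n → ℂ} {σc : ℕ → Euc n → ℂ} (h : IsCS χ (a : ℂ) σ σc)
    (hodd : ∀ (j : ℕ) (ξ : Euc n), ξ ≠ 0 →
      σc j (-ξ) = (-1 : ℂ) ^ (a - (j : ℤ)) * σc j ξ) (j : ℕ) :
    IsOddHom (a - j) (σc j) where
  smooth := h.comp_smooth j
  homog c hc ξ hξ := by
    have key : ∀ t : ℝ, 0 < t → ∀ η : Euc n, η ≠ 0 →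
        σc j (t • η) = (t : ℂ) ^ (a - (j : ℤ)) * σc j η := fun t ht η hη => by
      rw [h.comp_homog j t ht η hη, ← Complex.cpow_intCast]
      push_cast
      rfl
    rcases hc.lt_or_gt with hc | hc
    · have h1 := key (-c) (neg_pos.2 hc) (-ξ) (neg_ne_zero.2 hξ)
      rw [smul_neg, neg_smul, neg_neg, hodd j ξ hξ] at h1
      rw [h1, ← mul_assoc, ← mul_zpow]
      simp
    · exact key c hc ξ hξ

end Symbols

/-- The subspace `Z` contains all partial derivatives in `Dodd n χ` of elements of `Dodd n χ` and
all elements of `Dodd n χ` that are classical symbols of order with real part `< -K`. -/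
structure IsStokesNull {n : ℕ} (χ : Euc n → ℝ) (K : ℕ) (Z : Submodule ℂ (Euc n → ℂ)) :
    Prop where
  stokes : ∀ τ ∈ Dodd n χ, ∀ i, pd i τ ∈ Dodd n χ → pd i τ ∈ Z
  low_order : ∀ σ ∈ Dodd n χ, ∀ (a : ℂ) (σc : ℕ → Euc n → ℂ), IsCS χ a σ σc →
    a.re < -(K : ℝ) → σ ∈ Z

/-- The rotation by the angle `t` in the plane of the coordinates `a` and `b`. -/
def planeRot {n : ℕ} (a b : Fin n) (t : ℝ) (ξ : Euc n) : Euc n :=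
  ξ + (((Real.cos t - 1) * ξ a - Real.sin t * ξ b) • EuclideanSpace.single a (1 : ℝ) +
    (Real.sin t * ξ a + (Real.cos t - 1) * ξ b) • EuclideanSpace.single b (1 : ℝ))

section Rotations

variable {n : ℕ} {a b : Fin n}

lemma planeRot_apply (hab : a ≠ b) (t : ℝ) (ξ : Euc n) (k : Fin n) :
    planeRot a b t ξ k = if k = a then Real.cos t * ξ a - Real.sin t * ξ b
      else if k = b then Real.sin t * ξ a + Real.cos t * ξ b else ξ k := by
  by_cases h1 : k = a
  · subst h1
    simp [planeRot, hab]
    ring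
  · by_cases h2 : k = b
    · subst h2
      simp [planeRot, h1]
      ring
    · simp [planeRot, h1, h2]

lemma planeRot_add (hab : a ≠ b) (t s : ℝ) (ξ : Euc n) :
    planeRot a b t (planeRot a b s ξ) = planeRot a b (t + s) ξ := by
  ext k
  simp only [planeRot_apply hab, if_true, if_neg hab.symm, Real.cos_add, Real.sin_add]
  split_ifs <;> ring

@[simp]
lemma planeRot_zero (ξ : Euc n) : planeRot a b 0 ξ = ξ := by simp [planeRot]

lemma planeRot_smul (t c : ℝ) (ξ : Euc n) : planeRot a b t (c • ξ) = c • planeRot a b t ξ := by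
  simp only [planeRot, smul_add, smul_smul, PiLp.smul_apply, smul_eq_mul]
  congr 3 <;> ring

lemma planeRot_ne_zero (hab : a ≠ b) (t : ℝ) {ξ : Euc n} (hξ : ξ ≠ 0) :
    planeRot a b t ξ ≠ 0 := fun h => hξ <| by
  have h1 := planeRot_add hab (-t) t ξ
  rw [h, neg_add_cancel, planeRot_zero] at h1
  rw [← h1]
  simpa using planeRot_smul (a := a) (b := b) (-t) 0 0

lemma contDiff_planeRot :
    ContDiff ℝ (⊤ : ℕ∞) fun p : ℝ × Euc n => planeRot a b p.1 p.2 := by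
  have h (k : Fin n) : ContDiff ℝ (⊤ : ℕ∞) fun p : ℝ × Euc n => p.2 k :=
    (EuclideanSpace.proj (𝕜 := ℝ) k).contDiff.comp contDiff_snd
  have hc : ContDiff ℝ (⊤ : ℕ∞) fun p : ℝ × Euc n => Real.cos p.1 :=
    Real.contDiff_cos.comp contDiff_fst
  have hs : ContDiff ℝ (⊤ : ℕ∞) fun p : ℝ × Euc n => Real.sin p.1 :=
    Real.contDiff_sin.comp contDiff_fst
  exact contDiff_snd.add
    (((((hc.sub contDiff_const).mul (h a)).sub (hs.mul (h b))).smul contDiff_const).add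
      (((hs.mul (h a)).add ((hc.sub contDiff_const).mul (h b))).smul contDiff_const))

lemma hasDerivAt_planeRot (ξ : Euc n) :
    HasDerivAt (fun t => planeRot a b t ξ)
      (ξ a • EuclideanSpace.single b (1 : ℝ) - ξ b • EuclideanSpace.single a (1 : ℝ)) 0 := by
  have hc := (Real.hasDerivAt_cos 0).sub_const 1
  have hs := Real.hasDerivAt_sin 0
  have h1 := ((hc.mul_const (ξ a)).sub (hs.mul_const (ξ b))).smul_const
    (EuclideanSpace.single a (1 : ℝ))
  have h2 := ((hs.mul_const (ξ a)).add (hc.mul_const (ξ b))).smul_const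
    (EuclideanSpace.single b (1 : ℝ))
  refine ((h1.add h2).const_add ξ).congr_deriv ?_
  simp [sub_eq_neg_add]

variable {m : ℤ} {f : Euc n → ℂ}

lemma IsOddHom.comp_planeRot (hf : IsOddHom m f) (hab : a ≠ b) (t : ℝ) :
    IsOddHom m (fun ξ => f (planeRot a b t ξ)) :=
  hf.comp (contDiff_planeRot.comp (contDiff_const.prodMk contDiff_id)) (planeRot_smul t)
    fun _ => planeRot_ne_zero hab t

lemma IsOddHom.continuous_comp_planeRot (hf : IsOddHom m f) (hab : a ≠ b) {ξ : Euc n}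
    (hξ : ξ ≠ 0) : Continuous fun t => f (planeRot a b t ξ) :=
  hf.smooth.continuousOn.comp_continuous
    (contDiff_planeRot.continuous.comp (Continuous.prodMk continuous_id continuous_const))
    fun t => planeRot_ne_zero hab t hξ

open scoped Convolution in
lemma IsOddHom.integral_planeRot (hf : IsOddHom m f) (hab : a ≠ b) {w : ℝ → ℝ}
    (hw : Continuous w) {T : ℝ} (hT : 0 ≤ T) :
    IsOddHom m (fun ξ => ∫ t in (0 : ℝ)..T, (w t : ℂ) * f (planeRot a b t ξ)) where
  homog c hc ξ hξ := by
    rw [← intervalIntegral.integral_const_mul]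
    congr 1
    ext t
    rw [planeRot_smul, hf.homog c hc _ (planeRot_ne_zero hab t hξ)]
    ring
  smooth := by
    let β : ContDiffBump (0 : ℝ) := ⟨T + 1, T + 2, by positivity, by linarith⟩
    let g : Euc n → ℝ → ℂ := fun ξ s => (β s : ℂ) * f (planeRot a b (-s) ξ)
    have hg : ContDiffOn ℝ (⊤ : ℕ∞) ↿g ({(0 : Euc n)}ᶜ ×ˢ Set.univ) := by
      have h1 : ContDiff ℝ (⊤ : ℕ∞) fun p : Euc n × ℝ => (β p.2 : ℂ) :=
        Complex.ofRealCLM.contDiff.comp (β.contDiff.comp contDiff_snd)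
      have h2 : ContDiff ℝ (⊤ : ℕ∞) fun p : Euc n × ℝ => planeRot a b (-p.2) p.1 :=
        contDiff_planeRot.comp (contDiff_snd.neg.prodMk contDiff_fst)
      exact h1.contDiffOn.mul
        (hf.smooth.comp h2.contDiffOn fun p hp => planeRot_ne_zero hab _ hp.1)
    have hφ : LocallyIntegrable ((Set.Ioc 0 T).indicator w) volume :=
      ((hw.integrableOn_Icc.mono_set Set.Ioc_subset_Icc_self).integrable_indicator
        measurableSet_Ioc).locallyIntegrable
    have key := contDiffOn_convolution_right_with_param_comp (n := (⊤ : ℕ∞)) (μ := volume)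
      (ContinuousLinearMap.lsmul ℝ ℝ : ℝ →L[ℝ] ℂ →L[ℝ] ℂ) (v := fun _ : Euc n => (0 : ℝ))
      contDiffOn_const (g := g) (k := closedBall 0 (T + 2)) isOpen_compl_singleton
      (isCompact_closedBall _ _) (fun ξ s _ hs => by
        have : β s = 0 := β.zero_of_le_dist (by
          have := not_le.1 (mt mem_closedBall.2 hs)
          exact this.le)
        simp [g, this]) hφ hg
    refine key.congr fun ξ _ => ?_
    rw [convolution_def, intervalIntegral.integral_of_le hT, ← integral_indicator measurableSet_Ioc]
    congr 1
    ext t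
    by_cases ht : t ∈ Set.Ioc 0 T
    · have : β (-t) = 1 := β.one_of_mem_closedBall (by
        have h1 := ht.1
        have h2 := ht.2
        simp only [mem_closedBall, dist_zero_right, norm_neg, Real.norm_eq_abs, abs_of_pos h1]
        show t ≤ T + 1
        linarith)
      simp [ht, g, this]
    · simp [ht]

end Rotations

namespace IsStokesNull

variable {n : ℕ} {χ : Euc n → ℝ} {K : ℕ} {Z : Submodule ℂ (Euc n → ℂ)} {m : ℤ} {f : Euc n → ℂ}

lemma smoothing_mem (hZ : IsStokesNull χ K Z) {σ : Euc n → ℂ} (hσ : IsSmoothing σ) : σ ∈ Z := by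
  refine hZ.low_order σ (Submodule.subset_span (Or.inl hσ)) (-(K : ℂ) - 1) _
    (hσ.isCS ?_) ?_
  · have : (0 : ℝ) ≤ K := by positivity
    simp
    linarith
  · simp

lemma cut_pd_mem (hZ : IsStokesNull χ K Z) (hχ : IsCutoff χ) (hf : IsOddHom m f) (i : Fin n) :
    cut χ (pd i f) ∈ Z := by
  have h1 : IsSmoothing (pd i (cut χ f) - cut χ (pd i f)) := by
    refine isSmoothing_of_far_eq_zero ((pd_contDiff (hχ.contDiff_cut hf.smooth) i).sub
      (hχ.contDiff_cut (hf.pd i).smooth)) fun ξ hξ => ?_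
    rw [Pi.sub_apply, pd_eqOn isOpen_far (hχ.cut_eqOn f) i hξ, hχ.cut_eqOn _ hξ, sub_self]
  have h2 : pd i (cut χ f) ∈ Dodd n χ := by
    rw [← sub_add_cancel (pd i (cut χ f)) (cut χ (pd i f))]
    exact add_mem (Submodule.subset_span (Or.inl h1)) (hχ.cut_mem_Dodd (hf.pd i))
  have h3 := sub_mem (hZ.stokes _ (hχ.cut_mem_Dodd hf) i h2) (hZ.smoothing_mem h1)
  rwa [sub_sub_cancel] at h3

lemma cut_mem_of_ne (hZ : IsStokesNull χ K Z) (hχ : IsCutoff χ) (hf : IsOddHom m f)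
    (hm : m ≠ -n) : cut χ f ∈ Z := by
  have hmn : ((n : ℂ) + m) ≠ 0 := by
    intro h
    apply hm
    have : ((n + m : ℤ) : ℂ) = 0 := by push_cast; exact h
    have := Int.cast_eq_zero.1 this
    omega
  have h1 : cut χ (∑ i, pd i (fun ξ : Euc n => (ξ i : ℂ) * f ξ)) ∈ Z := by
    rw [map_sum]
    exact sum_mem fun i _ => hZ.cut_pd_mem hχ (hf.coord_mul i) i
  rw [hχ.cut_congr (g := ((n : ℂ) + m) • f), map_smul] at h1
  · exact (Submodule.smul_mem_iff Z hmn).1 h1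
  · intro ξ hξ
    simp only [Finset.sum_apply, pd_coord_mul (hf.differentiableAt hξ), if_true,
      Finset.sum_add_distrib, hf.sum_coord_mul_pd hξ]
    simp
    ring

lemma cut_mem_of_hasDerivAt (hZ : IsStokesNull χ K Z) (hχ : IsCutoff χ) {a b : Fin n}
    (hab : a ≠ b) (hf : IsOddHom m f) {q : Euc n → ℂ}
    (hq : ∀ ξ, ξ ≠ 0 → HasDerivAt (fun s => f (planeRot a b s ξ)) (q ξ) 0) : cut χ q ∈ Z := by
  have h1 := sub_mem (hZ.cut_pd_mem hχ (hf.coord_mul a) b) (hZ.cut_pd_mem hχ (hf.coord_mul b) a)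
  rw [← map_sub] at h1
  rwa [hχ.cut_congr fun ξ hξ => ?_] at h1
  have hd := hf.differentiableAt hξ
  have h2 : HasDerivAt (fun s => f (planeRot a b s ξ)) (fderiv ℝ f ξ _) 0 :=
    HasFDerivAt.comp_hasDerivAt (0 : ℝ) (by simpa using hd.hasFDerivAt) (hasDerivAt_planeRot ξ)
  rw [(hq ξ hξ).unique h2]
  simp only [Pi.sub_apply, pd_coord_mul hd, if_neg hab, if_neg hab.symm]
  simp [pd]

lemma cut_planeRot_sub_mem (hZ : IsStokesNull χ K Z) (hχ : IsCutoff χ) {a b : Fin n}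
    (hab : a ≠ b) (hf : IsOddHom m f) {T : ℝ} (hT : 0 ≤ T) :
    cut χ ((fun ξ => f (planeRot a b T ξ)) - f) ∈ Z := by
  refine hZ.cut_mem_of_hasDerivAt hχ hab
    (hf.integral_planeRot hab (w := fun _ => 1) continuous_const hT) fun ξ hξ => ?_
  set φ := fun t => f (planeRot a b t ξ) with hφ
  have hφc : Continuous φ := hf.continuous_comp_planeRot hab hξ
  have hφ_int (x y : ℝ) : IntervalIntegrable φ volume x y := hφc.intervalIntegrable x y
  have h1 (s : ℝ) : ∫ t in (0 : ℝ)..T, ((1 : ℝ) : ℂ) * f (planeRot a b t (planeRot a b s ξ)) =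
      (∫ t in (0 : ℝ)..(T + s), φ t) - ∫ t in (0 : ℝ)..s, φ t := by
    simp only [planeRot_add hab, Complex.ofReal_one, one_mul]
    rw [intervalIntegral.integral_interval_sub_left (hφ_int _ _) (hφ_int _ _)]
    have := intervalIntegral.integral_comp_add_right φ s (a := 0) (b := T)
    rwa [zero_add] at this
  simp only [h1]
  have h2 (x : ℝ) : HasDerivAt (fun u => ∫ t in (0 : ℝ)..u, φ t) (φ x) x :=
    hφc.integral_hasStrictDerivAt 0 x |>.hasDerivAt
  have h3 : HasDerivAt (fun s => ∫ t in (0 : ℝ)..(T + s), φ t) (φ T) 0 :=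
    HasDerivAt.comp_const_add T 0 (by simpa using h2 T)
  refine (h3.sub (h2 0)).congr_deriv ?_
  simp [hφ]

lemma cut_sub_average_mem (hZ : IsStokesNull χ K Z) (hχ : IsCutoff χ) {a b : Fin n}
    (hab : a ≠ b) (hf : IsOddHom m f) {T : ℝ} (hT : 0 ≤ T)
    (hper : ∀ ξ, f (planeRot a b T ξ) = f ξ) :
    cut χ ((T : ℂ) • f - fun ξ => ∫ t in (0 : ℝ)..T, ((1 : ℝ) : ℂ) * f (planeRot a b t ξ)) ∈ Z := by
  refine hZ.cut_mem_of_hasDerivAt hχ hab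
    (hf.integral_planeRot hab (w := fun t => t) continuous_id hT) fun ξ hξ => ?_
  set φ := fun t => f (planeRot a b t ξ) with hφ
  have hφc : Continuous φ := hf.continuous_comp_planeRot hab hξ
  set ψ : ℝ → ℂ := fun t => (t : ℂ) * φ t with hψ
  have hψc : Continuous ψ := by fun_prop
  have hφ_int (x y : ℝ) : IntervalIntegrable φ volume x y := hφc.intervalIntegrable x y
  have hψ_int (x y : ℝ) : IntervalIntegrable ψ volume x y := hψc.intervalIntegrable x y
  have h1 (s : ℝ) : ∫ t in (0 : ℝ)..T, (t : ℂ) * f (planeRot a b t (planeRot a b s ξ)) =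
      (∫ t in (0 : ℝ)..(T + s), ψ t) - (∫ t in (0 : ℝ)..s, ψ t) -
        s * ((∫ t in (0 : ℝ)..(T + s), φ t) - ∫ t in (0 : ℝ)..s, φ t) := by
    simp only [planeRot_add hab]
    rw [intervalIntegral.integral_interval_sub_left (hφ_int _ _) (hφ_int _ _),
      intervalIntegral.integral_interval_sub_left (hψ_int _ _) (hψ_int _ _),
      ← intervalIntegral.integral_const_mul,
      ← intervalIntegral.integral_sub (hψ_int _ _) ((hφ_int _ _).const_mul _)]
    have := intervalIntegral.integral_comp_add_right (fun t => ψ t - s * φ t) s (a := 0) (b := T)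
    rw [zero_add] at this
    rw [← this]
    congr 1
    ext t
    simp only [hψ, hφ]
    push_cast
    ring
  simp only [h1]
  have h2 (x : ℝ) : HasDerivAt (fun u => ∫ t in (0 : ℝ)..u, φ t) (φ x) x :=
    hφc.integral_hasStrictDerivAt 0 x |>.hasDerivAt
  have h2' (x : ℝ) : HasDerivAt (fun u => ∫ t in (0 : ℝ)..u, ψ t) (ψ x) x :=
    hψc.integral_hasStrictDerivAt 0 x |>.hasDerivAt
  have h3 : HasDerivAt (fun s => ∫ t in (0 : ℝ)..(T + s), φ t) (φ T) 0 :=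
    HasDerivAt.comp_const_add T 0 (by simpa using h2 T)
  have h3' : HasDerivAt (fun s => ∫ t in (0 : ℝ)..(T + s), ψ t) (ψ T) 0 :=
    HasDerivAt.comp_const_add T 0 (by simpa using h2' T)
  have h4 : HasDerivAt (fun s : ℝ => (s : ℂ)) 1 0 := Complex.ofRealCLM.hasDerivAt
  have h5 := (h3'.sub (h2' 0)).sub (h4.mul (h3.sub (h2 0)))
  refine h5.congr_deriv ?_
  simp [hψ, hφ, hper]

lemma exists_flip (hZ : IsStokesNull χ K Z) (hχ : IsCutoff χ) (m : ℤ) (j : ℕ)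
    (hj : 2 * j + 1 ≤ n) :
    ∃ A : Euc n → Euc n,
      (∀ ξ k, A ξ k = if 1 ≤ k.val ∧ k.val ≤ 2 * j then -ξ k else ξ k) ∧
      ∀ f, IsOddHom m f → IsOddHom m (fun ξ => f (A ξ)) ∧
        cut χ ((fun ξ => f (A ξ)) - f) ∈ Z := by
  induction j with
  | zero =>
    refine ⟨id, fun ξ k => (if_neg (by omega)).symm, fun f hf => ⟨hf, ?_⟩⟩
    have : (fun ξ => f (id ξ)) - f = 0 := sub_self f
    rw [this, map_zero]
    exact zero_mem Z
  | succ j ih =>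
    obtain ⟨A, hA, hAf⟩ := ih (by omega)
    let a : Fin n := ⟨2 * j + 1, by omega⟩
    let b : Fin n := ⟨2 * j + 2, by omega⟩
    have hab : a ≠ b := by simp [a, b]
    refine ⟨fun ξ => A (planeRot a b Real.pi ξ), fun ξ k => ?_, fun f hf => ?_⟩
    · simp only [hA, planeRot_apply hab, Real.cos_pi, Real.sin_pi]
      by_cases h1 : k = a
      · subst h1
        simp [a]
      · by_cases h2 : k = b
        · subst h2
          rw [if_neg (by simp [b]), if_neg h1, if_pos rfl, if_pos (by simp [b]; omega)]
          simp
        · have h1' : k.val ≠ 2 * j + 1 := fun h => h1 (Fin.ext h)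
          have h2' : k.val ≠ 2 * j + 2 := fun h => h2 (Fin.ext h)
          simp only [if_neg h1, if_neg h2]
          congr 1
          simp only [eq_iff_iff]
          omega
    · obtain ⟨h1, h2⟩ := hAf f hf
      refine ⟨h1.comp_planeRot hab _, ?_⟩
      have h3 := add_mem (hZ.cut_planeRot_sub_mem hχ hab h1 Real.pi_pos.le) h2
      rw [← map_add] at h3
      convert h3 using 2
      ext ξ
      simp

lemma cut_mem_of_eq (hZ : IsStokesNull χ K Z) (hχ : IsCutoff χ) (hn : 3 ≤ n) (hodd : Odd n)
    (hf : IsOddHom (-n) f) : cut χ f ∈ Z := by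
  let a : Fin n := ⟨0, by omega⟩
  let b : Fin n := ⟨1, by omega⟩
  have hab : a ≠ b := by simp [a, b]
  have hper (t : ℝ) (ξ : Euc n) : planeRot a b (t + 2 * Real.pi) ξ = planeRot a b t ξ := by
    simp [planeRot]
  set g : Euc n → ℂ := fun ξ =>
    ∫ t in (0 : ℝ)..(2 * Real.pi), ((1 : ℝ) : ℂ) * f (planeRot a b t ξ) with hg_def
  have hg : IsOddHom (-n) g :=
    hf.integral_planeRot hab (w := fun _ => 1) continuous_const Real.two_pi_pos.le
  have hg_rot (θ : ℝ) (ξ : Euc n) : g (planeRot a b θ ξ) = g ξ := by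
    simp only [hg_def, planeRot_add hab]
    have h1 := intervalIntegral.integral_comp_add_right
      (fun t => ((1 : ℝ) : ℂ) * f (planeRot a b t ξ)) θ (a := 0) (b := 2 * Real.pi)
    have h2 : Function.Periodic (fun t => ((1 : ℝ) : ℂ) * f (planeRot a b t ξ)) (2 * Real.pi) :=
      fun t => by simp only [hper]
    have h3 := h2.intervalIntegral_add_eq θ 0
    rw [h1, zero_add, add_comm (2 * Real.pi) θ, h3, zero_add]
  obtain ⟨j, hj⟩ := hodd
  obtain ⟨A, hA, hAf⟩ := hZ.exists_flip hχ (-n) j hj.ge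
  have hrot (ξ : Euc n) : ∃ θ, -(A ξ) = planeRot a b θ ξ := by
    obtain ⟨r, α, ha, hb⟩ : ∃ r α : ℝ, ξ a = r * Real.cos α ∧ ξ b = r * Real.sin α := by
      let z : ℂ := ⟨ξ a, ξ b⟩
      exact ⟨‖z‖, z.arg, (Complex.norm_mul_cos_arg z).symm, (Complex.norm_mul_sin_arg z).symm⟩
    refine ⟨Real.pi - 2 * α, ?_⟩
    have hsq := Real.sin_sq_add_cos_sq α
    ext k
    rw [planeRot_apply hab, PiLp.neg_apply, hA, Real.cos_pi_sub, Real.sin_pi_sub, Real.cos_two_mul,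
      Real.sin_two_mul]
    by_cases h1 : k = a
    · rw [if_pos h1, if_neg (by simp [h1, a]), h1, ha, hb]
      linear_combination (2 * r * Real.cos α) * hsq
    · by_cases h2 : k = b
      · have : 1 ≤ 2 * j := by omega
        rw [if_neg h1, if_pos h2, if_pos (by simp [h2, b, this]), h2, ha, hb]
        ring
      · have h1' : k.val ≠ 0 := fun h => h1 (Fin.ext h)
        have := k.isLt
        rw [if_neg h1, if_neg h2, if_pos (by omega), neg_neg]
  have hgA (ξ : Euc n) (hξ : ξ ≠ 0) : g (A ξ) = -g ξ := by
    obtain ⟨θ, hθ⟩ := hrot ξ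
    have h1 := hg.homog (-1) (by norm_num) _ (planeRot_ne_zero hab θ hξ)
    rw [hg_rot, ← hθ, neg_one_smul, neg_neg] at h1
    rw [h1]
    have : Odd (-(n : ℤ)) := by
      rw [odd_neg]
      exact ⟨j, by omega⟩
    push_cast
    rw [this.neg_one_zpow]
    ring
  have h1 := (hAf g hg).2
  rw [hχ.cut_congr (g := (-2 : ℂ) • g), map_smul, Submodule.smul_mem_iff Z (by norm_num)] at h1
  · have h2 := add_mem (hZ.cut_sub_average_mem hχ hab hf Real.two_pi_pos.le
      (fun ξ => by simpa using congrArg f (hper 0 ξ))) h1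
    rw [← map_add, sub_add_cancel, map_smul] at h2
    exact (Submodule.smul_mem_iff Z (by exact_mod_cast Real.two_pi_pos.ne')).1 h2
  · intro ξ hξ
    simp [hgA ξ hξ]
    ring

lemma Dodd_le (hZ : IsStokesNull χ K Z) (hχ : IsCutoff χ) (hn : 3 ≤ n) (hodd : Odd n) :
    Dodd n χ ≤ Z := by
  refine Submodule.span_le.2 ?_
  rintro σ (hσ | ⟨a, σc, hσ, hσc⟩)
  · exact hZ.smoothing_mem hσ
  have hc := hσ.isOddHom hσc
  have hcut (j : ℕ) : cut χ (σc j) ∈ Z := by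
    by_cases hm : a - j = -n
    · exact hZ.cut_mem_of_eq hχ hn hodd (hm ▸ hc j)
    · exact hZ.cut_mem_of_ne hχ (hc j) hm
  obtain ⟨N, hN⟩ := exists_nat_gt ((a : ℝ) + K)
  have h1 : σ - ∑ j ∈ Finset.range N, cut χ (σc j) ∈ Z := by
    refine hZ.low_order _ (sub_mem (Submodule.subset_span (Or.inr ⟨a, σc, hσ, hσc⟩))
      (sum_mem fun j _ => hχ.cut_mem_Dodd (hc j))) _ _
      (hσ.sub_sum N fun j => hχ.contDiff_cut (hc j).smooth) ?_
    simp
    linarith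
  have := add_mem h1 (sum_mem fun j (_ : j ∈ Finset.range N) => hcut j)
  rwa [sub_add_cancel] at this

end IsStokesNull

/-- In odd dimensions, a closed linear form on odd-class symbols is entirely determined
by its restriction to symbols of order of real part `< -K`. -/
theorem closed_form_determined_odd {n : ℕ} (hn : 3 ≤ n) (hodd : Odd n)
    {χ : Euc n → ℝ} (hχ : IsCutoff χ) (K : ℕ) (hK : 0 < K) (hKn : K ≤ n)
    (ρ₁ ρ₂ : Dodd n χ →ₗ[ℂ] ℂ)
    (hst1 : ∀ (τ σ : Dodd n χ) (i : Fin n),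
      (σ : Euc n → ℂ) = pd i (τ : Euc n → ℂ) → ρ₁ σ = 0)
    (hst2 : ∀ (τ σ : Dodd n χ) (i : Fin n),
      (σ : Euc n → ℂ) = pd i (τ : Euc n → ℂ) → ρ₂ σ = 0)
    (hagree : ∀ (σ : Dodd n χ) (a : ℂ) (σc : ℕ → Euc n → ℂ),
      IsCS χ a (σ : Euc n → ℂ) σc → a.re < -(K : ℝ) → ρ₁ σ = ρ₂ σ) :
    ∀ σ : Dodd n χ, ρ₁ σ = ρ₂ σ := by
  have hZ : IsStokesNull χ K ((LinearMap.ker (ρ₁ - ρ₂)).map (Dodd n χ).subtype) := by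
    refine ⟨fun τ hτ i hi => ⟨⟨pd i τ, hi⟩, ?_, rfl⟩, fun σ hσ a σc hcs ha => ⟨⟨σ, hσ⟩, ?_, rfl⟩⟩
    · have h1 := hst1 ⟨τ, hτ⟩ ⟨pd i τ, hi⟩ i rfl
      have h2 := hst2 ⟨τ, hτ⟩ ⟨pd i τ, hi⟩ i rfl
      simp [h1, h2]
    · have := hagree ⟨σ, hσ⟩ a σc hcs ha
      simp [this]
  intro σ
  obtain ⟨τ, hτ, hτσ⟩ := hZ.Dodd_le hχ hn hodd σ.2
  obtain rfl : τ = σ := Subtype.ext hτσ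
  simpa [sub_eq_zero] using hτ

end
end

section
/- Let U ⊆ ℝⁿ be open (n ≥ 2) and let τ be a classical symbol of order a with compact support in U. Then the noncommutative residue satisfies Stokes' property in both sets of variables: (i) res(∂_{x_j}τ) = 0 for every j = 1,…,n; and (ii) if σ is a classical symbol with compact support in U such that σ − ∂_{ξ_j}τ is a smoothing symbol for some j, then res(σ) = 0. Moreover res vanishes on smoothing symbols. -/
open MeasureTheory Metric Filter Complex
open scoped Topology RealInnerProductSpace Classical

noncomputable section

/-- Partial derivative in the `i`-th direction of the first (`x`) variable. -/
def pdFst {n : ℕ} (i : Fin n) (f : Euc n → Euc n → ℂ) : Euc n → Euc n → ℂ :=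
  fun x ξ => fderiv ℝ (fun x' => f x' ξ) x (EuclideanSpace.single i 1)

/-- Partial derivative in the `i`-th direction of the second (`ξ`) variable. -/
def pdSnd {n : ℕ} (i : Fin n) (f : Euc n → Euc n → ℂ) : Euc n → Euc n → ℂ :=
  fun x ξ => fderiv ℝ (fun ξ' => f x ξ') ξ (EuclideanSpace.single i 1)

/-- Iterated partial derivatives in the first variable. -/
def pdIterFst {n : ℕ} : List (Fin n) → (Euc n → Euc n → ℂ) → (Euc n → Euc n → ℂ)
  | [], f => f
  | i :: L, f => pdFst i (pdIterFst L f)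

/-- Iterated partial derivatives in the second variable. -/
def pdIterSnd {n : ℕ} : List (Fin n) → (Euc n → Euc n → ℂ) → (Euc n → Euc n → ℂ)
  | [], f => f
  | i :: L, f => pdSnd i (pdIterSnd L f)

/-- `σ` is a classical symbol of order `a` with compact support in `U`, with homogeneous
components `σc j` of degree `a - j` in `ξ`. -/
structure IsCSCpt {n : ℕ} (U : Set (Euc n)) (χ : Euc n → ℝ) (a : ℂ)
    (σ : Euc n → Euc n → ℂ) (σc : ℕ → Euc n → Euc n → ℂ) : Prop where
  smooth : ContDiff ℝ (⊤ : ℕ∞) (fun p : Euc n × Euc n => σ p.1 p.2)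
  supp : ∃ K : Set (Euc n), IsCompact K ∧ K ⊆ U ∧
    ∀ x ∉ K, (∀ ξ, σ x ξ = 0) ∧ ∀ j ξ, σc j x ξ = 0
  comp_smooth : ∀ j, ContDiffOn ℝ (⊤ : ℕ∞) (fun p : Euc n × Euc n => σc j p.1 p.2)
    {p : Euc n × Euc n | p.2 ≠ 0}
  comp_homog : ∀ (j : ℕ) (t : ℝ), 0 < t → ∀ (x : Euc n) (ξ : Euc n), ξ ≠ 0 →
    σc j x (t • ξ) = (t : ℂ) ^ (a - j) * σc j x ξ
  estimate : ∀ (N : ℕ) (Lξ Lx : List (Fin n)), ∃ C > (0:ℝ), ∀ (x ξ : Euc n),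
    ‖pdIterSnd Lξ (pdIterFst Lx
        (fun y η => σ y η - ∑ j ∈ Finset.range N, (χ η : ℂ) * σc j y η)) x ξ‖ ≤
      C * (1 + ‖ξ‖) ^ (a.re - N - Lξ.length : ℝ)

/-- A smoothing symbol with compact support in `U`. -/
def IsSmoothingCpt {n : ℕ} (U : Set (Euc n)) (σ : Euc n → Euc n → ℂ) : Prop :=
  ContDiff ℝ (⊤ : ℕ∞) (fun p : Euc n × Euc n => σ p.1 p.2) ∧
  (∃ K : Set (Euc n), IsCompact K ∧ K ⊆ U ∧ ∀ x ∉ K, ∀ ξ, σ x ξ = 0) ∧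
  ∀ (Lξ Lx : List (Fin n)) (M : ℝ), 0 < M → ∃ C > (0:ℝ), ∀ (x ξ : Euc n),
    ‖pdIterSnd Lξ (pdIterFst Lx σ) x ξ‖ ≤ C * (1 + ‖ξ‖) ^ (-M)

/-- The noncommutative residue of a classical symbol with compact support in `U`. -/
def resCpt {n : ℕ} (U : Set (Euc n)) (a : ℂ) (σc : ℕ → Euc n → Euc n → ℂ) : ℂ :=
  if h : ∃ j : ℕ, a - j = -(n : ℂ) then
    ((((2 * Real.pi) ^ n)⁻¹ : ℝ) : ℂ) *
      ∫ x in U, sphInt (σc h.choose x)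
  else 0

theorem exists_real_cpow_ne {c d : ℂ} (h : c ≠ d) : ∃ l : ℝ, 0 < l ∧ (l : ℂ) ^ c ≠ (l : ℂ) ^ d := by
  refine ⟨Real.exp (‖c - d‖⁻¹), Real.exp_pos _, fun H => ?_⟩
  have h0 : 0 < ‖c - d‖ := norm_pos_iff.2 (sub_ne_zero.2 h)
  have hne : ((Real.exp (‖c - d‖⁻¹) : ℝ) : ℂ) ≠ 0 := by
    exact_mod_cast (Real.exp_pos _).ne'
  rw [cpow_def_of_ne_zero hne, cpow_def_of_ne_zero hne, ← ofReal_log (Real.exp_pos _).le,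
    Real.log_exp, Complex.exp_eq_exp_iff_exists_int] at H
  obtain ⟨k, hk⟩ := H
  have h1 : ((‖c - d‖⁻¹ : ℝ) : ℂ) * (c - d) = k * (2 * Real.pi * I) := by
    rw [mul_sub, hk]; ring
  have h2 := congrArg norm h1
  rw [norm_mul, norm_real, norm_inv, norm_norm, inv_mul_cancel₀ h0.ne'] at h2
  simp only [norm_mul, norm_intCast, norm_I, mul_one, Complex.norm_ofNat, norm_real,
    Real.norm_eq_abs, abs_of_pos Real.pi_pos] at h2
  rcases eq_or_ne k 0 with rfl | hk0
  · simp at h2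
  · have : (1 : ℝ) ≤ |(k : ℝ)| := by exact_mod_cast Int.one_le_abs hk0
    nlinarith [Real.pi_gt_three]

/-- Complex powers with nonnegative real part of the exponent are linearly independent
at infinity modulo functions tending to `0`. -/
theorem coeff_eq_zero_of_tendsto_sum_cpow (s : Finset ℂ) : ∀ v : ℂ → ℂ,
    Tendsto (fun t : ℝ => ∑ c ∈ s, v c * (t : ℂ) ^ c) atTop (𝓝 0) →
    ∀ c ∈ s, 0 ≤ c.re → v c = 0 := by
  induction s using Finset.induction_on with
  | empty => simp
  | insert d s hd ih =>
    intro v hv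
    have key : ∀ c ∈ s, 0 ≤ c.re → v c = 0 := by
      intro c hc hre
      have hcd : c ≠ d := fun h => hd (h ▸ hc)
      obtain ⟨l, hl, hne⟩ := exists_real_cpow_ne hcd
      have h1 := (hv.comp (tendsto_id.const_mul_atTop hl)).sub (hv.const_mul ((l : ℂ) ^ d))
      have h2 := ih (fun c => v c * ((l : ℂ) ^ c - (l : ℂ) ^ d)) (by
        simp only [mul_zero, sub_zero] at h1
        refine h1.congr' ?_
        filter_upwards [eventually_gt_atTop 0] with t ht
        simp only [Function.comp_apply, id, ofReal_mul, mul_cpow_ofReal_nonneg hl.le ht.le,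
          Finset.sum_insert hd, mul_add, Finset.mul_sum]
        rw [add_sub_add_comm, ← Finset.sum_sub_distrib]
        rw [show v d * ((l : ℂ) ^ d * (t : ℂ) ^ d) - (l : ℂ) ^ d * (v d * (t : ℂ) ^ d) = 0 by ring,
          zero_add]
        exact Finset.sum_congr rfl fun c _ => by ring) c hc hre
      exact (mul_eq_zero.1 h2).resolve_right (sub_ne_zero.2 hne)
    intro c hc hre
    rcases Finset.mem_insert.1 hc with rfl | hc
    · have hs : Tendsto (fun t : ℝ => ∑ c ∈ s, v c * (t : ℂ) ^ c) atTop (𝓝 0) := by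
        rw [← Finset.sum_const_zero (s := s)]
        refine tendsto_finsetSum _ fun e he => ?_
        rcases le_or_gt 0 e.re with h | h
        · simp [key e he h]
        · rw [← mul_zero (v e)]
          refine Tendsto.const_mul _ (tendsto_zero_iff_norm_tendsto_zero.2 ?_)
          refine (tendsto_rpow_neg_atTop (neg_pos.2 h)).congr' ?_
          filter_upwards [eventually_gt_atTop 0] with t ht
          rw [norm_cpow_eq_rpow_re_of_pos ht, neg_neg]
      have h1 := (hv.sub hs).norm
      simp only [Finset.sum_insert hd, add_sub_cancel_right, sub_zero, norm_zero] at h1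
      refine norm_le_zero_iff.1 (ge_of_tendsto h1 ?_)
      filter_upwards [eventually_ge_atTop 1] with t ht
      rw [norm_mul, norm_cpow_eq_rpow_re_of_pos (by linarith)]
      exact le_mul_of_one_le_right (norm_nonneg _) (Real.one_le_rpow ht hre)
    · exact key c hc hre

theorem sum_fiber_eq_zero_of_tendsto_sum_cpow {ι : Type*} (s : Finset ι) (e v : ι → ℂ)
    (h : Tendsto (fun t : ℝ => ∑ i ∈ s, v i * (t : ℂ) ^ e i) atTop (𝓝 0)) {z : ℂ}
    (hz : 0 ≤ z.re) : ∑ i ∈ s with e i = z, v i = 0 := by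
  by_cases hzs : z ∈ s.image e
  · refine coeff_eq_zero_of_tendsto_sum_cpow (s.image e) (fun z => ∑ i ∈ s with e i = z, v i) ?_
      z hzs hz
    refine h.congr fun t => ?_
    rw [← Finset.sum_fiberwise_of_maps_to (fun i hi => Finset.mem_image_of_mem e hi)]
    refine Finset.sum_congr rfl fun c _ => ?_
    rw [Finset.sum_mul]
    exact Finset.sum_congr rfl fun i hi => by rw [(Finset.mem_filter.1 hi).2]
  · refine Finset.sum_eq_zero fun i hi => (hzs ?_).elim
    rw [Finset.mem_filter] at hi
    exact hi.2 ▸ Finset.mem_image_of_mem e hi.1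

/-- Uniqueness of asymptotic expansions along a ray: the coefficient of `t ^ (-n)` is the same
in both expansions. -/
theorem expansion_coeff_eq {n : ℕ} {f g : ℝ → ℂ} {b a : ℂ} {s d : ℕ → ℂ}
    (hf : ∀ N : ℕ, ∃ C > (0 : ℝ), ∀ t : ℝ, 1 < t →
      ‖f t - ∑ j ∈ Finset.range N, s j * (t : ℂ) ^ (b - j)‖ ≤ C * (1 + t) ^ (b.re - N))
    (hg : ∀ N : ℕ, ∃ C > (0 : ℝ), ∀ t : ℝ, 1 < t →
      ‖g t - ∑ j ∈ Finset.range N, d j * (t : ℂ) ^ (a - j)‖ ≤ C * (1 + t) ^ (a.re - N))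
    (hfg : ∀ M : ℝ, 0 < M → ∃ C > (0 : ℝ), ∀ t : ℝ, 1 < t → ‖f t - g t‖ ≤ C * (1 + t) ^ (-M))
    {i : ℕ} (hi : b - i = -(n : ℂ)) :
    (∃ k : ℕ, a - k = -(n : ℂ) ∧ s i = d k) ∨ ((∀ k : ℕ, a - k ≠ -(n : ℂ)) ∧ s i = 0) := by
  obtain ⟨N₀, hN₀⟩ := exists_nat_ge (b.re + n + 1)
  obtain ⟨M₀, hM₀⟩ := exists_nat_ge (a.re + n + 1)
  set N := max N₀ (i + 1) with hN
  have hNb : b.re - N ≤ -(n + 1 : ℝ) := by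
    have : (N₀ : ℝ) ≤ N := by exact_mod_cast le_max_left _ _
    linarith
  have hiN : i ∈ Finset.range N := Finset.mem_range.2 (lt_of_lt_of_le (Nat.lt_succ_self i)
    (le_max_right _ _))
  have hMa : a.re - M₀ ≤ -(n + 1 : ℝ) := by linarith
  obtain ⟨C₁, hC₁, h₁⟩ := hf N
  obtain ⟨C₂, hC₂, h₂⟩ := hg M₀
  obtain ⟨C₃, hC₃, h₃⟩ := hfg (n + 1) (by positivity)
  have hmono : ∀ {t p : ℝ}, 1 < t → p ≤ -(n + 1 : ℝ) → (1 + t) ^ p ≤ t ^ (-(n + 1 : ℝ)) := by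
    intro t p ht hp
    calc (1 + t) ^ p ≤ (1 + t) ^ (-(n + 1 : ℝ)) :=
          Real.rpow_le_rpow_of_exponent_le (by linarith) hp
      _ ≤ t ^ (-(n + 1 : ℝ)) := Real.rpow_le_rpow_of_nonpos (by linarith) (by linarith)
          (by have : (0 : ℝ) ≤ n := n.cast_nonneg
              linarith)
  have hbound : ∀ t : ℝ, 1 < t → ‖(∑ j ∈ Finset.range N, s j * (t : ℂ) ^ (b - j)) -
      ∑ j ∈ Finset.range M₀, d j * (t : ℂ) ^ (a - j)‖ ≤
        (C₁ + C₂ + C₃) * t ^ (-(n + 1 : ℝ)) := by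
    intro t ht
    have e₁ := (h₁ t ht).trans (mul_le_mul_of_nonneg_left (hmono ht hNb) hC₁.le)
    have e₂ := (h₂ t ht).trans (mul_le_mul_of_nonneg_left (hmono ht hMa) hC₂.le)
    have e₃ := (h₃ t ht).trans (mul_le_mul_of_nonneg_left (hmono ht le_rfl) hC₃.le)
    set A := ∑ j ∈ Finset.range N, s j * (t : ℂ) ^ (b - j)
    set B := ∑ j ∈ Finset.range M₀, d j * (t : ℂ) ^ (a - j)
    have : A - B = (f t - g t) - (f t - A) + (g t - B) := by ring
    rw [this]
    have := norm_add_le ((f t - g t) - (f t - A)) (g t - B)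
    have := norm_sub_le (f t - g t) (f t - A)
    linarith
  have hlim : Tendsto (fun t : ℝ => ∑ k ∈ (Finset.range N).disjSum (Finset.range M₀),
      Sum.elim s (fun k => -d k) k * (t : ℂ) ^
        (Sum.elim (fun j : ℕ => b - j + n) (fun j : ℕ => a - j + n) k : ℂ)) atTop (𝓝 0) := by
    refine squeeze_zero_norm' ?_ (a := fun t : ℝ => (C₁ + C₂ + C₃) * t⁻¹) ?_
    · filter_upwards [eventually_gt_atTop 1] with t ht
      have ht0 : 0 < t := by linarith
      have htc : (t : ℂ) ≠ 0 := by exact_mod_cast ht0.ne'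
      have : ∑ k ∈ (Finset.range N).disjSum (Finset.range M₀),
          Sum.elim s (fun k => -d k) k * (t : ℂ) ^
            (Sum.elim (fun j : ℕ => b - j + n) (fun j : ℕ => a - j + n) k : ℂ) =
          ((∑ j ∈ Finset.range N, s j * (t : ℂ) ^ (b - j)) -
            ∑ j ∈ Finset.range M₀, d j * (t : ℂ) ^ (a - j)) * (t : ℂ) ^ n := by
        simp only [Finset.sum_disjSum, Sum.elim_inl, Sum.elim_inr, cpow_add _ _ htc, cpow_natCast,
          sub_mul, Finset.sum_mul, neg_mul, Finset.sum_neg_distrib, mul_assoc]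
        ring
      rw [this, norm_mul, norm_pow, norm_real, Real.norm_of_nonneg ht0.le]
      refine (mul_le_mul_of_nonneg_right (hbound t ht) (by positivity)).trans_eq ?_
      rw [mul_assoc, ← Real.rpow_natCast, ← Real.rpow_add ht0, ← Real.rpow_neg_one]
      congr 2
      ring
    · simpa using tendsto_inv_atTop_zero.const_mul (C₁ + C₂ + C₃)
  have hsum : (∑ j ∈ Finset.range N, if b - (j : ℂ) + n = 0 then s j else 0) +
      ∑ k ∈ Finset.range M₀, (if a - (k : ℂ) + n = 0 then -d k else 0) = 0 := by
    have := sum_fiber_eq_zero_of_tendsto_sum_cpow _ _ _ hlim (z := 0) (by simp)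
    rw [Finset.sum_filter, Finset.sum_disjSum] at this
    convert this <;> rfl
  rw [Finset.sum_eq_single_of_mem i hiN (fun j _ hj => if_neg fun h => hj ?_),
    if_pos (by rw [hi]; ring)] at hsum
  · by_cases hk : ∃ k ∈ Finset.range M₀, a - (k : ℂ) + n = 0
    · obtain ⟨k, hkM, hk⟩ := hk
      rw [Finset.sum_eq_single_of_mem k hkM (fun j _ hj => if_neg fun h => hj ?_),
        if_pos hk] at hsum
      · exact .inl ⟨k, by linear_combination hk, by linear_combination hsum⟩
      · exact_mod_cast (by linear_combination hk - h : (j : ℂ) = k)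
    · push Not at hk
      rw [Finset.sum_eq_zero fun k hkM => if_neg (hk k hkM), add_zero] at hsum
      refine .inr ⟨fun k hka => hk k (Finset.mem_range.2 ?_) (by rw [hka]; ring), hsum⟩
      have := congrArg Complex.re hka
      simp only [sub_re, natCast_re, neg_re] at this
      exact_mod_cast (by linarith : (k : ℝ) < M₀)
  · exact_mod_cast (by linear_combination hi - h : (j : ℂ) = i)

theorem integral_eq_sphInt_mul {n : ℕ} (hn : 0 < n) {F G : Euc n → ℂ} {A : ℝ → ℂ}
    (h : ∀ r : ℝ, 0 < r → ∀ ω : Euc n, ‖ω‖ = 1 → F (r • ω) = G ω * A r) :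
    ∫ x, F x = sphInt G * ∫ r in Set.Ioi (0 : ℝ), ((r ^ (n - 1) : ℝ) : ℂ) * A r := by
  have : Nonempty (Fin n) := ⟨⟨0, hn⟩⟩
  have : Nontrivial (Euc n) := inferInstance
  have hdim : Module.finrank ℝ (Euc n) = n := by simp
  calc ∫ x, F x = ∫ x : ({0}ᶜ : Set (Euc n)), F x ∂(volume.comap Subtype.val) := by
        rw [integral_subtype_comap (measurableSet_singleton _).compl F,
          restrict_compl_singleton]
    _ = ∫ p, G p.1 * A p.2 ∂(volume : Measure (Euc n)).toSphere.prod
          (.volumeIoiPow (Module.finrank ℝ (Euc n) - 1)) := by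
      rw [← (volume : Measure (Euc n)).measurePreserving_homeomorphUnitSphereProd.integral_comp
        (Homeomorph.measurableEmbedding _)]
      refine integral_congr_ae (.of_forall fun x => ?_)
      have hx : (0 : ℝ) < ‖(x : Euc n)‖ := norm_pos_iff.2 x.2
      have := h ‖(x : Euc n)‖ hx (‖(x : Euc n)‖⁻¹ • (x : Euc n))
        (by rw [norm_smul, norm_inv, norm_norm, inv_mul_cancel₀ hx.ne'])
      rw [smul_smul, mul_inv_cancel₀ hx.ne', one_smul] at this
      simpa using this
    _ = sphInt G * ∫ r : Set.Ioi (0 : ℝ), A r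
          ∂.volumeIoiPow (Module.finrank ℝ (Euc n) - 1) :=
      integral_prod_mul (fun ω : sphere (0 : Euc n) 1 => G ω) (fun r : Set.Ioi (0 : ℝ) => A r)
    _ = _ := by
      congr 1
      simp only [Measure.volumeIoiPow, ENNReal.ofReal, hdim]
      rw [integral_withDensity_eq_integral_smul,
        integral_subtype_comap measurableSet_Ioi fun a ↦ Real.toNNReal (a ^ (n - 1)) • A a]
      · refine setIntegral_congr_fun measurableSet_Ioi fun x hx => ?_
        simp only [NNReal.smul_def]
        rw [Real.coe_toNNReal _ (pow_nonneg (le_of_lt hx) _), real_smul]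
      · exact (measurable_subtype_coe.pow_const _).real_toNNReal

theorem fderiv_smul_of_homogeneous {n : ℕ} {g : Euc n → ℂ} {c : ℂ}
    (hg : DifferentiableOn ℝ g {0}ᶜ)
    (hom : ∀ t : ℝ, 0 < t → ∀ ξ : Euc n, ξ ≠ 0 → g (t • ξ) = (t : ℂ) ^ c * g ξ)
    {t : ℝ} (ht : 0 < t) {ξ : Euc n} (hξ : ξ ≠ 0) (v : Euc n) :
    fderiv ℝ g (t • ξ) v = (t : ℂ) ^ (c - 1) * fderiv ℝ g ξ v := by
  have hd : ∀ η : Euc n, η ≠ 0 → DifferentiableAt ℝ g η := fun η hη =>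
    hg.differentiableAt (isOpen_compl_singleton.mem_nhds hη)
  have htc : (t : ℂ) ≠ 0 := by exact_mod_cast ht.ne'
  have h1 : HasFDerivAt (fun η => g (t • η))
      ((fderiv ℝ g (t • ξ)).comp (t • ContinuousLinearMap.id ℝ (Euc n))) ξ :=
    (hd _ (smul_ne_zero ht.ne' hξ)).hasFDerivAt.comp ξ ((hasFDerivAt_id ξ).const_smul t)
  have h2 : HasFDerivAt (fun η => g (t • η)) ((t : ℂ) ^ c • fderiv ℝ g ξ) ξ :=
    ((hd ξ hξ).hasFDerivAt.const_mul ((t : ℂ) ^ c)).congr_of_eventuallyEq <| by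
      filter_upwards [isOpen_compl_singleton.mem_nhds hξ] with η hη using hom t ht η hη
  have h3 := congrArg (fun L : Euc n →L[ℝ] ℂ => L v) (h1.unique h2)
  simp only [ContinuousLinearMap.comp_apply, _root_.smul_apply,
    ContinuousLinearMap.id_apply, map_smul, real_smul, smul_eq_mul] at h3
  rw [cpow_sub _ _ htc, cpow_one]
  field_simp
  linear_combination h3

theorem continuous_mul_of_tsupport_subset {X R : Type*} [TopologicalSpace X] [TopologicalSpace R]
    [MulZeroClass R] [ContinuousMul R] {f g : X → R}
    {s : Set X} (hs : IsOpen s) (hf : Continuous f) (hfs : tsupport f ⊆ s)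
    (hg : ContinuousOn g s) : Continuous fun x => f x * g x :=
  continuous_of_tsupport fun _ hx => hf.continuousAt.mul <|
    hg.continuousAt (hs.mem_nhds (hfs (tsupport_mul_subset_left hx)))

/-- The partial derivatives of a function homogeneous of degree `1 - n` on `ℝⁿ ∖ {0}` have
vanishing integral over the unit sphere. -/
theorem sphInt_fderiv_eq_zero {n : ℕ} (hn : 0 < n) {g : Euc n → ℂ}
    (hg : ContDiffOn ℝ (⊤ : ℕ∞) g {0}ᶜ)
    (hom : ∀ t : ℝ, 0 < t → ∀ ξ : Euc n, ξ ≠ 0 → g (t • ξ) = (t : ℂ) ^ (1 - n : ℂ) * g ξ)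
    (v : Euc n) : sphInt (fun ξ => fderiv ℝ g ξ v) = 0 := by
  have hS : IsOpen ({0}ᶜ : Set (Euc n)) := isOpen_compl_singleton
  have hgd : DifferentiableOn ℝ g {0}ᶜ := hg.differentiableOn (by simp)
  have hg' : ContinuousOn (fun ξ => fderiv ℝ g ξ v) {0}ᶜ :=
    (hg.continuousOn_fderiv_of_isOpen hS (by simp)).clm_apply continuousOn_const
  let ψ : ContDiffBump (2 : ℝ) := ⟨1 / 2, 1, by norm_num, by norm_num⟩
  let φ : Euc n → ℂ := fun ξ => (ψ (‖ξ‖ ^ 2) : ℂ)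
  have hφ : ContDiff ℝ 1 φ := ofRealCLM.contDiff.comp (ψ.contDiff.comp (contDiff_norm_sq ℝ))
  have hzero : ∀ y : ℝ, y ≤ 1 ∨ 3 ≤ y → ψ y = 0 := fun y hy => by
    refine ψ.zero_of_le_dist ?_
    rw [Real.dist_eq, le_abs]
    rcases hy with hy | hy
    · right; change (1 : ℝ) ≤ _; linarith
    · left; change (1 : ℝ) ≤ _; linarith
  have hsupp : tsupport φ ⊆ {ξ | 1 ≤ ‖ξ‖ ∧ ‖ξ‖ ≤ 3} := by
    refine closure_minimal (fun ξ hξ => ?_)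
      ((isClosed_le continuous_const continuous_norm).inter
        (isClosed_le continuous_norm continuous_const))
    by_contra hc
    refine hξ ?_
    change ((ψ (‖ξ‖ ^ 2) : ℝ) : ℂ) = 0
    rw [hzero, ofReal_zero]
    simp only [Set.mem_ofPred_eq, not_and_or, not_le] at hc
    rcases hc with hc | hc
    · left; nlinarith [norm_nonneg ξ]
    · right; nlinarith
  have hφc : HasCompactSupport φ :=
    HasCompactSupport.of_support_subset_isCompact (isCompact_closedBall (0 : Euc n) 3)
      fun ξ hξ => by simpa using (hsupp (subset_tsupport _ hξ)).2
  have hφs : tsupport φ ⊆ {0}ᶜ := fun ξ hξ h0 => by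
    have := (hsupp hξ).1
    simp only [Set.mem_singleton_iff.1 h0, norm_zero] at this
    linarith
  have hφ'c : HasCompactSupport (fun ξ => fderiv ℝ φ ξ v) := hφc.fderiv_apply ℝ v
  have hφ's : tsupport (fun ξ => fderiv ℝ φ ξ v) ⊆ {0}ᶜ :=
    (tsupport_fderiv_apply_subset ℝ v).trans hφs
  have hφ'cont : Continuous (fun ξ => fderiv ℝ φ ξ v) :=
    (hφ.continuous_fderiv (by simp)).clm_apply continuous_const
  have parts := integral_mul_fderiv_eq_neg_fderiv_mul_of_integrable (μ := volume) (f := φ) (g := g)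
    (v := v)
    ((continuous_mul_of_tsupport_subset hS hφ'cont hφ's hg.continuousOn).integrable_of_hasCompactSupport
      hφ'c.mul_right)
    ((continuous_mul_of_tsupport_subset hS hφ.continuous hφs hg').integrable_of_hasCompactSupport
      hφc.mul_right)
    ((continuous_mul_of_tsupport_subset hS hφ.continuous hφs
      hg.continuousOn).integrable_of_hasCompactSupport hφc.mul_right)
    (fun ξ _ => hφ.differentiable (by simp) ξ)
    (fun ξ hξ => hgd.differentiableAt (hS.mem_nhds (hφs hξ)))
  have hderiv : ∀ ξ, fderiv ℝ φ ξ v = ((deriv ψ (‖ξ‖ ^ 2) * (2 * inner ℝ ξ v) : ℝ) : ℂ) := by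
    intro ξ
    have h1 : HasDerivAt ψ (deriv ψ (‖ξ‖ ^ 2)) (‖ξ‖ ^ 2) :=
      (ψ.contDiff.differentiable (n := 1) (by simp) _).hasDerivAt
    have h2 : HasFDerivAt (fun ξ : Euc n => ‖ξ‖ ^ 2) (2 • innerSL ℝ ξ) ξ :=
      (hasStrictFDerivAt_norm_sq ξ).hasFDerivAt
    have h3 := (ofRealCLM.hasFDerivAt).comp ξ (h1.comp_hasFDerivAt ξ h2)
    have h4 : fderiv ℝ φ ξ = _ := h3.fderiv
    rw [h4]
    simp
  have hrad : ∀ ξ : Euc n, ‖ξ‖ = 1 → ξ ≠ 0 := fun ξ h h0 => by simp [h0] at h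
  have hpow : ∀ r : ℝ, 0 < r → ((r ^ (n - 1) : ℝ) : ℂ) * (r : ℂ) ^ (1 - n : ℂ) = 1 := by
    intro r hr
    have hrc : (r : ℂ) ≠ 0 := by exact_mod_cast hr.ne'
    rw [ofReal_pow, ← cpow_natCast, ← cpow_add _ _ hrc, Nat.cast_sub hn]
    simp
  let θ : ℝ → ℝ := fun r => ψ (r ^ 2)
  have hθ : ContDiff ℝ 1 θ := ψ.contDiff.comp (contDiff_id.pow 2)
  have hθc : HasCompactSupport θ :=
    HasCompactSupport.of_support_subset_isCompact (isCompact_Icc (a := (-3 : ℝ)) (b := 3))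
      fun r hr => by
        by_contra hc
        refine hr (hzero _ (.inr ?_))
        rw [Set.mem_Icc, not_and_or, not_le, not_le] at hc
        rcases hc with hc | hc <;> nlinarith
  rw [integral_eq_sphInt_mul hn (G := fun ξ => fderiv ℝ g ξ v)
      (A := fun r => (ψ (r ^ 2) : ℂ) * (r : ℂ) ^ (1 - n - 1 : ℂ)),
    integral_eq_sphInt_mul hn (G := fun ξ => (inner ℝ ξ v : ℂ) * g ξ)
      (A := fun r => ((deriv ψ (r ^ 2) * (2 * r) : ℝ) : ℂ) * (r : ℂ) ^ (1 - n : ℂ))] at parts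
  · have hz : ∫ r in Set.Ioi (0 : ℝ), ((r ^ (n - 1) : ℝ) : ℂ) *
        (((deriv ψ (r ^ 2) * (2 * r) : ℝ) : ℂ) * (r : ℂ) ^ (1 - n : ℂ)) = 0 := by
      have hθd : ∀ r, deriv θ r = deriv ψ (r ^ 2) * (2 * r) := fun r => by
        have h1 : HasDerivAt ψ (deriv ψ (r ^ 2)) (r ^ 2) :=
          (ψ.contDiff.differentiable (n := 1) (by simp) _).hasDerivAt
        have h2 : HasDerivAt θ (deriv ψ (r ^ 2) * (2 * r)) r := by
          simpa [θ, Function.comp_def] using!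
            HasDerivAt.comp (h := fun r : ℝ => r ^ 2) r h1 (hasDerivAt_pow 2 r)
        exact h2.deriv
      have h1 := hθc.integral_Ioi_deriv_eq hθ 0
      have h2 : θ 0 = 0 := hzero _ (.inl (by norm_num))
      rw [h2, neg_zero] at h1
      have h3 := integral_ofReal (𝕜 := ℂ) (f := deriv θ) (μ := volume.restrict (Set.Ioi 0))
      rw [h1] at h3
      refine Eq.trans ?_ (h3.trans ofReal_zero)
      refine setIntegral_congr_fun measurableSet_Ioi fun r hr => ?_
      simp only [hθd]
      rw [mul_left_comm, hpow r hr, mul_one]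
      rfl
    have hpos : ∫ r in Set.Ioi (0 : ℝ), ((r ^ (n - 1) : ℝ) : ℂ) *
        ((ψ (r ^ 2) : ℂ) * (r : ℂ) ^ (1 - n - 1 : ℂ)) ≠ 0 := by
      let k : ℝ → ℝ := fun r => θ r * (max r 1)⁻¹
      have hk : Continuous k := hθ.continuous.mul
        ((continuous_id.max continuous_const).inv₀ fun r => by positivity)
      have hk0 : ∀ r, 0 ≤ k r := fun r => mul_nonneg ψ.nonneg (by positivity)
      have hkI : ∫ r in Set.Ioi (0 : ℝ), ((r ^ (n - 1) : ℝ) : ℂ) *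
          ((ψ (r ^ 2) : ℂ) * (r : ℂ) ^ (1 - n - 1 : ℂ)) =
          ((∫ r in Set.Ioi (0 : ℝ), k r : ℝ) : ℂ) := by
        refine Eq.trans ?_ (integral_ofReal (𝕜 := ℂ) (f := k) (μ := volume.restrict (Set.Ioi 0)))
        refine setIntegral_congr_fun measurableSet_Ioi fun r (hr : 0 < r) => ?_
        have hrc : (r : ℂ) ≠ 0 := by exact_mod_cast hr.ne'
        rw [mul_left_comm, cpow_sub _ _ hrc, ← mul_div_assoc, hpow r hr, cpow_one]
        rcases le_total r 1 with h | h
        · simp [k, θ, hzero (r ^ 2) (.inl (by nlinarith))]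
        · simp [k, θ, max_eq_left h]
      rw [hkI, Ne, ofReal_eq_zero]
      refine ((setIntegral_pos_iff_support_of_nonneg_ae (.of_forall hk0)
        (hk.integrable_of_hasCompactSupport hθc.mul_right).integrableOn).2 ?_).ne'
      refine lt_of_lt_of_le ?_ (measure_mono (s := Set.Ioo (1.2 : ℝ) 1.5) fun r hr => ?_)
      · rw [Real.volume_Ioo, ENNReal.ofReal_pos]; norm_num
      · obtain ⟨h1, h2⟩ := hr
        refine ⟨?_, Set.mem_Ioi.2 (by linarith)⟩
        have : 0 < θ r := ψ.pos_of_mem_ball (by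
          rw [mem_ball, Real.dist_eq, abs_lt]
          change -(1 : ℝ) < _ ∧ _ < (1 : ℝ)
          constructor <;> nlinarith)
        exact (mul_pos this (by positivity)).ne'
    rw [hz, mul_zero, neg_zero] at parts
    exact (mul_eq_zero.1 parts).resolve_right hpos
  · intro r hr ω hω
    rw [hderiv, hom r hr ω (hrad ω hω), norm_smul, hω, inner_smul_left, mul_one,
      Real.norm_of_nonneg hr.le]
    push_cast
    simp
    ring
  · intro r hr ω hω
    rw [fderiv_smul_of_homogeneous hgd hom hr (hrad ω hω)]
    simp only [φ, norm_smul, hω, mul_one, Real.norm_of_nonneg hr.le]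
    ring

section Symbols

variable {n : ℕ} {U : Set (Euc n)} {χ : Euc n → ℝ} {a : ℂ} {τ : Euc n → Euc n → ℂ}
  {τc : ℕ → Euc n → Euc n → ℂ}

theorem IsCSCpt.comp_contDiffOn_right (hτ : IsCSCpt U χ a τ τc) (k : ℕ) (x : Euc n) :
    ContDiffOn ℝ (⊤ : ℕ∞) (τc k x) {0}ᶜ :=
  (hτ.comp_smooth k).comp (f := fun ξ => (x, ξ)) (by fun_prop) fun _ hξ => hξ

theorem IsCSCpt.comp_contDiff_left (hτ : IsCSCpt U χ a τ τc) (k : ℕ) {ξ : Euc n} (hξ : ξ ≠ 0) :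
    ContDiff ℝ (⊤ : ℕ∞) (fun x => τc k x ξ) :=
  contDiffOn_univ.1 <|
    (hτ.comp_smooth k).comp (f := fun x => (x, ξ)) (by fun_prop) fun _ _ => hξ

theorem IsCSCpt.contDiff_right (hτ : IsCSCpt U χ a τ τc) (x : Euc n) :
    ContDiff ℝ (⊤ : ℕ∞) (τ x) :=
  hτ.smooth.comp (f := fun ξ => (x, ξ)) (by fun_prop)

theorem norm_smul_of_norm_eq_one {t : ℝ} (ht : 1 < t) {ω : Euc n} (hω : ‖ω‖ = 1) : ‖t • ω‖ = t := by
  rw [norm_smul, hω, mul_one, Real.norm_of_nonneg (by linarith)]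

theorem IsCSCpt.expansion (hχ : IsCutoff χ) (hτ : IsCSCpt U χ a τ τc) (x : Euc n) {ω : Euc n}
    (hω : ‖ω‖ = 1) (N : ℕ) : ∃ C > (0 : ℝ), ∀ t : ℝ, 1 < t →
      ‖τ x (t • ω) - ∑ k ∈ Finset.range N, τc k x ω * (t : ℂ) ^ (a - k)‖ ≤
        C * (1 + t) ^ (a.re - N) := by
  obtain ⟨C, hC, h⟩ := hτ.estimate N [] []
  refine ⟨C, hC, fun t ht => ?_⟩
  have hω0 : ω ≠ 0 := by rintro rfl; simp at hω
  have := h x (t • ω)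
  simp only [pdIterSnd, pdIterFst, norm_smul_of_norm_eq_one ht hω, hχ.one_far (t • ω)
    (by rw [norm_smul_of_norm_eq_one ht hω]; exact ht.le), ofReal_one, one_mul, List.length_nil,
    Nat.cast_zero, sub_zero] at this
  simpa only [hτ.comp_homog _ t (by linarith) x ω hω0, mul_comm] using this

theorem IsCSCpt.expansion_pdSnd (hχ : IsCutoff χ) (hτ : IsCSCpt U χ a τ τc) (i : Fin n)
    (x : Euc n) {ω : Euc n} (hω : ‖ω‖ = 1) (N : ℕ) : ∃ C > (0 : ℝ), ∀ t : ℝ, 1 < t →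
      ‖pdSnd i τ x (t • ω) -
        ∑ k ∈ Finset.range N, pdSnd i (τc k) x ω * (t : ℂ) ^ (a - 1 - k)‖ ≤
        C * (1 + t) ^ ((a - 1).re - N) := by
  obtain ⟨C, hC, h⟩ := hτ.estimate N [i] []
  refine ⟨C, hC, fun t ht => ?_⟩
  have ht0 : 0 < t := by linarith
  have hω0 : ω ≠ 0 := by rintro rfl; simp at hω
  have htω : t • ω ≠ 0 := smul_ne_zero ht0.ne' hω0
  have hdiff : ∀ k, DifferentiableOn ℝ (τc k x) {0}ᶜ := fun k =>
    (hτ.comp_contDiffOn_right k x).differentiableOn (by simp)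
  have hev : (fun η => τ x η - ∑ k ∈ Finset.range N, (χ η : ℂ) * τc k x η) =ᶠ[𝓝 (t • ω)]
      fun η => τ x η - ∑ k ∈ Finset.range N, τc k x η := by
    have : {η : Euc n | 1 < ‖η‖} ∈ 𝓝 (t • ω) :=
      (isOpen_lt continuous_const continuous_norm).mem_nhds
        (by simpa [norm_smul_of_norm_eq_one ht hω] using ht)
    filter_upwards [this] with η hη
    simp [hχ.one_far η (le_of_lt hη)]
  have hfd : HasFDerivAt (fun η => τ x η - ∑ k ∈ Finset.range N, τc k x η)
      (fderiv ℝ (τ x) (t • ω) - ∑ k ∈ Finset.range N, fderiv ℝ (τc k x) (t • ω)) (t • ω) :=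
    ((hτ.contDiff_right x).differentiable (by simp) _).hasFDerivAt.sub
      (HasFDerivAt.fun_sum fun k _ =>
        ((hdiff k).differentiableAt (isOpen_compl_singleton.mem_nhds htω)).hasFDerivAt)
  have := h x (t • ω)
  simp only [pdIterSnd, pdIterFst, norm_smul_of_norm_eq_one ht hω, List.length_singleton,
    Nat.cast_one] at this
  rw [pdSnd, hev.fderiv_eq, hfd.fderiv] at this
  simp only [_root_.sub_apply, _root_.sum_apply,
    fderiv_smul_of_homogeneous (hdiff _) (fun s hs ξ hξ => hτ.comp_homog _ s hs x ξ hξ) ht0 hω0,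
    sub_right_comm a _ 1] at this
  rw [sub_re, one_re, sub_right_comm]
  simpa only [pdSnd, mul_comm] using this

theorem pdFst_eq_zero_of_notMem {K : Set (Euc n)} (hK : IsClosed K) {f : Euc n → Euc n → ℂ}
    {ξ : Euc n} (hf : ∀ x ∉ K, f x ξ = 0) (i : Fin n) {x : Euc n} (hx : x ∉ K) :
    pdFst i f x ξ = 0 := by
  have : (fun x' => f x' ξ) =ᶠ[𝓝 x] fun _ => 0 := by
    filter_upwards [hK.isOpen_compl.mem_nhds hx] with y hy using hf y hy
  rw [pdFst, this.fderiv_eq]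
  simp

theorem integral_fderiv_apply_eq_zero {f : Euc n → ℂ} (hf : ContDiff ℝ 1 f)
    (hc : HasCompactSupport f) (v : Euc n) : ∫ x, fderiv ℝ f x v = 0 := by
  have h := integral_mul_fderiv_eq_neg_fderiv_mul_of_integrable (μ := volume)
    (f := fun _ : Euc n => (1 : ℂ)) (g := f) (v := v) (by simp)
    (by simpa using ((hf.continuous_fderiv (by simp)).clm_apply
      continuous_const).integrable_of_hasCompactSupport (hc.fderiv_apply ℝ v))
    (by simpa using hf.continuous.integrable_of_hasCompactSupport hc)
    (fun _ _ => by simp) (fun x _ => hf.differentiable (by simp) x)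
  simpa using h

theorem IsCSCpt.integral_sphInt_pdFst (hτ : IsCSCpt U χ a τ τc) (i : Fin n) (k : ℕ) :
    ∫ x in U, sphInt (pdFst i (τc k) x) = 0 := by
  obtain ⟨K, hK, hKU, hsupp⟩ := hτ.supp
  have hz : ∀ x ∉ K, ∀ ξ, pdFst i (τc k) x ξ = 0 := fun x hx ξ =>
    pdFst_eq_zero_of_notMem hK.isClosed (fun y hy => (hsupp y hy).2 k ξ) i hx
  have hω0 : ∀ ω : sphere (0 : Euc n) 1, (ω : Euc n) ≠ 0 := ne_zero_of_mem_unit_sphere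
  have hS : IsOpen {p : Euc n × Euc n | p.2 ≠ 0} :=
    isOpen_compl_singleton.preimage continuous_snd
  let F : Euc n × Euc n → ℂ := fun p => τc k p.1 p.2
  have hF : ContDiffOn ℝ (⊤ : ℕ∞) F {p | p.2 ≠ 0} := hτ.comp_smooth k
  have hpd : ∀ x ξ, ξ ≠ 0 → pdFst i (τc k) x ξ =
      fderiv ℝ F (x, ξ) (EuclideanSpace.single i 1, 0) := by
    intro x ξ hξ
    have h1 : HasFDerivAt F (fderiv ℝ F (x, ξ)) (x, ξ) :=
      ((hF.differentiableOn (by simp)).differentiableAt (hS.mem_nhds hξ)).hasFDerivAt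
    have h2 : HasFDerivAt (fun x' => τc k x' ξ)
        ((fderiv ℝ F (x, ξ)).comp (.inl ℝ (Euc n) (Euc n))) x :=
      HasFDerivAt.comp (g := F) (f := fun x' => (x', ξ)) x h1 (hasFDerivAt_prodMk_left x ξ)
    rw [pdFst, h2.fderiv]
    simp
  have hcont : Continuous fun p : Euc n × sphere (0 : Euc n) 1 =>
      pdFst i (τc k) p.1 (p.2 : Euc n) := by
    simp only [hpd _ _ (hω0 _)]
    exact ((hF.continuousOn_fderiv_of_isOpen hS (by simp)).clm_apply
      continuousOn_const).comp_continuous (f := fun p : Euc n × sphere (0 : Euc n) 1 =>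
        (p.1, (p.2 : Euc n))) (by fun_prop) fun p => hω0 p.2
  have : IsFiniteMeasure (sphMeas n) := by unfold sphMeas; infer_instance
  have hint : Integrable (fun p : Euc n × sphere (0 : Euc n) 1 =>
      pdFst i (τc k) p.1 (p.2 : Euc n)) (volume.prod (sphMeas n)) :=
    hcont.integrable_of_hasCompactSupport <|
      HasCompactSupport.of_support_subset_isCompact (hK.prod isCompact_univ) fun p hp =>
        ⟨by_contra fun h => hp (hz _ h _), trivial⟩
  rw [setIntegral_eq_integral_of_forall_compl_eq_zero fun x hx => by
    simp [sphInt, hz x fun h => hx (hKU h)]]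
  simp only [sphInt]
  rw [integral_integral_swap hint]
  refine integral_eq_zero_of_ae (.of_forall fun ω => ?_)
  refine integral_fderiv_apply_eq_zero ((hτ.comp_contDiff_left k (hω0 ω)).of_le (by simp)) ?_ _
  exact HasCompactSupport.of_support_subset_isCompact hK fun x hx =>
    by_contra fun h => hx ((hsupp x h).2 k ω)

theorem resCpt_eq_zero {σc : ℕ → Euc n → Euc n → ℂ}
    (h : ∀ j : ℕ, a - j = -(n : ℂ) → ∫ x in U, sphInt (σc j x) = 0) : resCpt U a σc = 0 := by
  unfold resCpt
  split_ifs with hj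
  · rw [h _ hj.choose_spec, mul_zero]
  · rfl

theorem sphInt_congr {f g : Euc n → ℂ} (h : ∀ ω : Euc n, ‖ω‖ = 1 → f ω = g ω) :
    sphInt f = sphInt g :=
  integral_congr_ae (.of_forall fun ω => h ω (by simp))

theorem IsCSCpt.resCpt_eq_zero_of_smoothing (hχ : IsCutoff χ) (hτ : IsCSCpt U χ a τ τc)
    (h : IsSmoothingCpt U τ) : resCpt U a τc = 0 := by
  refine resCpt_eq_zero fun i hi => integral_eq_zero_of_ae (.of_forall fun x => ?_)
  have : sphInt (τc i x) = sphInt fun _ => 0 := sphInt_congr fun ω hω => by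
    have hdecay : ∀ M : ℝ, 0 < M → ∃ C > (0 : ℝ), ∀ t : ℝ, 1 < t →
        ‖τ x (t • ω) - 0‖ ≤ C * (1 + t) ^ (-M) := fun M hM => by
      obtain ⟨C, hC, hb⟩ := h.2.2 [] [] M hM
      refine ⟨C, hC, fun t ht => ?_⟩
      have := hb x (t • ω)
      rw [norm_smul_of_norm_eq_one ht hω] at this
      simpa [pdIterSnd, pdIterFst] using this
    rcases expansion_coeff_eq (a := 0) (g := fun _ => 0) (d := fun _ => 0)
      (hτ.expansion hχ x hω) (fun N => ⟨1, one_pos, fun t ht => by simp; positivity⟩)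
      hdecay hi with ⟨_, _, h⟩ | ⟨_, h⟩ <;> exact h
  simpa [sphInt] using this

theorem IsCSCpt.resCpt_eq_zero_of_sub_pdSnd_smoothing (hn : 0 < n) (hχ : IsCutoff χ)
    (hτ : IsCSCpt U χ a τ τc) {b : ℂ} {σ : Euc n → Euc n → ℂ} {σc : ℕ → Euc n → Euc n → ℂ}
    (hσ : IsCSCpt U χ b σ σc) (j : Fin n)
    (h : IsSmoothingCpt U fun x ξ => σ x ξ - pdSnd j τ x ξ) : resCpt U b σc = 0 := by
  refine resCpt_eq_zero fun i hi => integral_eq_zero_of_ae (.of_forall fun x => ?_)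
  have key : ∀ ω : Euc n, ‖ω‖ = 1 →
      (∃ k : ℕ, a - 1 - k = -(n : ℂ) ∧ σc i x ω = pdSnd j (τc k) x ω) ∨
        ((∀ k : ℕ, a - 1 - k ≠ -(n : ℂ)) ∧ σc i x ω = 0) := fun ω hω => by
    refine expansion_coeff_eq (hσ.expansion hχ x hω) (hτ.expansion_pdSnd hχ j x hω)
      (fun M hM => ?_) hi (d := fun k => pdSnd j (τc k) x ω)
    obtain ⟨C, hC, hb⟩ := h.2.2 [] [] M hM
    refine ⟨C, hC, fun t ht => ?_⟩
    have := hb x (t • ω)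
    rw [norm_smul_of_norm_eq_one ht hω] at this
    exact this
  by_cases hk : ∃ k : ℕ, a - 1 - k = -(n : ℂ)
  · obtain ⟨k, hk⟩ := hk
    have : sphInt (σc i x) = sphInt (pdSnd j (τc k) x) := sphInt_congr fun ω hω => by
      rcases key ω hω with ⟨l, hl, h⟩ | ⟨h, _⟩
      · have : l = k := by exact_mod_cast (by linear_combination hk - hl : (l : ℂ) = k)
        rw [h, this]
      · exact (h k hk).elim
    refine this.trans (sphInt_fderiv_eq_zero hn (hτ.comp_contDiffOn_right k x)
      (fun t ht ξ hξ => ?_) _)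
    rw [hτ.comp_homog k t ht x ξ hξ, show a - k = 1 - (n : ℂ) by linear_combination hk]
  · have : sphInt (σc i x) = sphInt fun _ => 0 := sphInt_congr fun ω hω => by
      rcases key ω hω with ⟨l, hl, _⟩ | ⟨_, h⟩
      · exact (hk ⟨l, hl⟩).elim
      · exact h
    simpa [sphInt] using this

end Symbols

/-- **Stokes' property of the noncommutative residue on symbols with compact support**:
the residue vanishes on `x`-derivatives, on `ξ`-derivatives up to smoothing symbols,
and on smoothing symbols. -/
theorem resCpt_stokes {n : ℕ} (hn : 2 ≤ n) (U : Set (Euc n)) (hU : IsOpen U)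
    {χ : Euc n → ℝ} (hχ : IsCutoff χ) (a : ℂ)
    (τ : Euc n → Euc n → ℂ) (τc : ℕ → Euc n → Euc n → ℂ)
    (hτ : IsCSCpt U χ a τ τc) :
    (∀ j : Fin n, resCpt U a (fun j' => pdFst j (τc j')) = 0) ∧
    (∀ (b : ℂ) (σ : Euc n → Euc n → ℂ) (σc : ℕ → Euc n → Euc n → ℂ) (j : Fin n),
      IsCSCpt U χ b σ σc →
      IsSmoothingCpt U (fun x ξ => σ x ξ - pdSnd j τ x ξ) →
      resCpt U b σc = 0) ∧
    (∀ (b : ℂ) (σ : Euc n → Euc n → ℂ) (σc : ℕ → Euc n → Euc n → ℂ),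
      IsCSCpt U χ b σ σc → IsSmoothingCpt U σ → resCpt U b σc = 0) := by
  have hn0 : 0 < n := by omega
  exact ⟨fun j => resCpt_eq_zero fun k _ => hτ.integral_sphInt_pdFst j k,
    fun b σ σc j hσ h => hτ.resCpt_eq_zero_of_sub_pdSnd_smoothing hn0 hχ hσ j h,
    fun b σ σc hσ h => hσ.resCpt_eq_zero_of_smoothing hχ h⟩

end
end
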